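/- Let Y₁ and Y₂ be C_b^∞-vector fields on ℝ^d, γ ∈ (0,1] and N ≥ 2 an integer. Then there exist c > 0 and C_b^∞-vector fields Z₂, …, Z_N, where each Z_j is a real linear combination of iterated commutators of Y₁, Y₂ of length j, such that ‖e^{t(Y₁+Y₂)}φ − φ‖₂ ≤ c ( ‖e^{tY₁}φ − φ‖₂ + ‖e^{tY₂}φ − φ‖₂ + Σ_{j=2}^N ‖e^{t^j Z_j}φ − φ‖₂ + |t|^{γ(N+1)} ‖φ‖_{2;γ} ) for all φ ∈ C_c^∞(ℝ^d) and t ∈ [−1,1]. -/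

import Mathlib

open MeasureTheory Complex Real Finset

noncomputable section

/-- Euclidean space `ℝ^d`. -/
abbrev Ec (d : ℕ) := EuclideanSpace ℝ (Fin d)

variable {d : ℕ}

/-- The `L²` norm of a complex-valued function. -/
def l2norm (f : Ec d → ℂ) : ℝ := (∫ x, ‖f x‖ ^ 2).sqrt

/-- Smooth compactly supported test functions. -/
def IsCc (φ : Ec d → ℂ) : Prop := ContDiff ℝ (⊤ : ℕ∞) φ ∧ HasCompactSupport φ

/-- A `C_b^∞`-vector field on `ℝ^d`: a smooth coefficient map `a : ℝ^d → ℝ^d` which is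
bounded together with all its derivatives. -/
def IsCbVF (a : Ec d → Ec d) : Prop :=
  ContDiff ℝ (⊤ : ℕ∞) a ∧ ∀ n : ℕ, ∃ C : ℝ, ∀ x, ‖iteratedFDeriv ℝ n a x‖ ≤ C

/-- `f` is the (smooth, globally defined) flow `f t x = exp(tX)(x)` of the vector field
with coefficient map `a`:  `f 0 x = x` and `∂_t f t x = a (f t x)`. -/
def IsFlowOf (a : Ec d → Ec d) (f : ℝ → Ec d → Ec d) : Prop :=
  ContDiff ℝ (⊤ : ℕ∞) (fun p : ℝ × Ec d => f p.1 p.2) ∧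
    (∀ x, f 0 x = x) ∧
    ∀ t x, HasDerivAt (fun s => f s x) (a (f t x)) t

/-- The universal Hölder norm
`‖φ‖_{2;γ} = ‖φ‖₂ + sup_{0<|z|≤1} |z|^{-γ} ‖φ(· - z) - φ‖₂`. -/
def uHolder (γ : ℝ) (φ : Ec d → ℂ) : ℝ :=
  l2norm φ +
    sSup ((fun z : Ec d => ‖z‖ ^ (-γ) * l2norm fun x => φ (x - z) - φ x) ''
      {z : Ec d | 0 < ‖z‖ ∧ ‖z‖ ≤ 1})

/-- The commutator `[X,Y]` of vector fields, as coefficient maps: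
`[X,Y] = ∑_k (X b_k - Y a_k) ∂_k`. -/
def vfComm (a b : Ec d → Ec d) : Ec d → Ec d :=
  fun x => fderiv ℝ b x (a x) - fderiv ℝ a x (b x)

/-- The iterated commutator `X_{[α]} = [X_{i₁},[X_{i₂},…,[X_{i_{n-1}},X_{i_n}]…]]`
associated with a multi-index `α` given as a list. -/
def multiComm {ι : Type*} (X : ι → Ec d → Ec d) : List ι → (Ec d → Ec d)
  | [] => fun _ => 0
  | [i] => X i
  | i :: j :: l => vfComm (X i) (multiComm X (j :: l))

/-- A map between normed spaces that is smooth and bounded together with all its derivatives. -/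
def IsCb {E F : Type} [NormedAddCommGroup E] [NormedSpace ℝ E] [NormedAddCommGroup F]
    [NormedSpace ℝ F] (a : E → F) : Prop :=
  ContDiff ℝ (⊤ : ℕ∞) a ∧ ∀ n : ℕ, ∃ C : ℝ, ∀ x, ‖iteratedFDeriv ℝ n a x‖ ≤ C

section Cb

variable {E F G : Type} [NormedAddCommGroup E] [NormedSpace ℝ E] [NormedAddCommGroup F]
  [NormedSpace ℝ F] [NormedAddCommGroup G] [NormedSpace ℝ G]

lemma IsCb.differentiable {a : E → F} (ha : IsCb a) : Differentiable ℝ a :=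
  ha.1.differentiable (by simp)

lemma IsCb.bounded {a : E → F} (ha : IsCb a) : ∃ C : ℝ, 0 ≤ C ∧ ∀ x, ‖a x‖ ≤ C := by
  obtain ⟨C, hC⟩ := ha.2 0
  simp only [norm_iteratedFDeriv_zero] at hC
  exact ⟨C, (norm_nonneg _).trans (hC 0), hC⟩

lemma IsCb.fderiv {a : E → F} (ha : IsCb a) : IsCb (fderiv ℝ a) := by
  refine ⟨ha.1.fderiv_right (by simp), fun n => ?_⟩
  obtain ⟨C, hC⟩ := ha.2 (n + 1)
  exact ⟨C, fun x => by rw [norm_iteratedFDeriv_fderiv]; exact hC x⟩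

lemma IsCb.lipschitz {a : E → F} (ha : IsCb a) : ∃ K : NNReal, LipschitzWith K a := by
  obtain ⟨C, hC0, hC⟩ := ha.fderiv.bounded
  exact ⟨⟨C, hC0⟩, lipschitzWith_of_nnnorm_fderiv_le ha.differentiable hC⟩

lemma IsCb.zero : IsCb (fun _ : E => (0 : F)) :=
  ⟨contDiff_const, fun n => ⟨0, fun x => by
    rw [show (fun _ : E => (0 : F)) = 0 from rfl, iteratedFDeriv_zero]; simp⟩⟩

lemma IsCb.add {a b : E → F} (ha : IsCb a) (hb : IsCb b) : IsCb (fun x => a x + b x) := by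
  refine ⟨ha.1.add hb.1, fun n => ?_⟩
  obtain ⟨C, hC⟩ := ha.2 n
  obtain ⟨D, hD⟩ := hb.2 n
  refine ⟨C + D, fun x => ?_⟩
  have := iteratedFDeriv_add_apply (x := x) (i := n) (𝕜 := ℝ) (f := a) (g := b)
    (ha.1.contDiffAt.of_le (by exact_mod_cast le_top))
    (hb.1.contDiffAt.of_le (by exact_mod_cast le_top))
  rw [show (fun x => a x + b x) = a + b from rfl, this]
  exact (norm_add_le _ _).trans (add_le_add (hC x) (hD x))

lemma IsCb.const_smul {a : E → F} (ha : IsCb a) (c : ℝ) : IsCb (fun x => c • a x) := by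
  refine ⟨contDiff_const.smul ha.1, fun n => ?_⟩
  obtain ⟨C, hC⟩ := ha.2 n
  refine ⟨‖c‖ * C, fun x => ?_⟩
  have := iteratedFDeriv_const_smul_apply (x := x) (i := n) (𝕜 := ℝ) (a := c) (f := a)
    (ha.1.contDiffAt.of_le (by exact_mod_cast le_top))
  rw [show (fun x => c • a x) = c • a from rfl, this, norm_smul]
  gcongr
  exact hC x

lemma IsCb.sub {a b : E → F} (ha : IsCb a) (hb : IsCb b) : IsCb (fun x => a x - b x) := by
  simpa [sub_eq_add_neg] using ha.add (hb.const_smul (-1))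

lemma IsCb.clm_apply {a : E → F →L[ℝ] G} {b : E → F} (ha : IsCb a) (hb : IsCb b) :
    IsCb (fun x => a x (b x)) := by
  refine ⟨ha.1.clm_apply hb.1, fun n => ?_⟩
  choose C hC using ha.2
  choose D hD using hb.2
  refine ⟨∑ i ∈ Finset.range (n + 1), (n.choose i : ℝ) * C i * D (n - i), fun x => ?_⟩
  refine (norm_iteratedFDeriv_clm_apply ha.1 hb.1 x (by exact_mod_cast le_top)).trans ?_
  have h0 : ∀ i, 0 ≤ C i := fun i => (norm_nonneg _).trans (hC i x)
  gcongr with i hi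
  · exact mul_nonneg (by positivity) (h0 i)
  · exact hC i x
  · exact hD _ x

lemma IsCb.quadratic_remainder {a : E → F} (ha : IsCb a) : ∃ C : ℝ, 0 ≤ C ∧
    ∀ x y, ‖a y - a x - _root_.fderiv ℝ a x (y - x)‖ ≤ C * ‖y - x‖ ^ 2 := by
  obtain ⟨K, hK⟩ := ha.fderiv.lipschitz
  refine ⟨K, K.2, fun x y => ?_⟩
  have h := Convex.norm_image_sub_le_of_norm_hasFDerivWithin_le'
    (f := a) (f' := _root_.fderiv ℝ a) (φ := _root_.fderiv ℝ a x) (C := K * ‖y - x‖)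
    (s := segment ℝ x y) (x := x) (y := y)
    (fun z _ => (ha.differentiable z).hasFDerivAt.hasFDerivWithinAt) (fun z hz => ?_)
    (convex_segment x y) (left_mem_segment _ _ _) (right_mem_segment _ _ _)
  · calc _ ≤ _ := h
      _ = _ := by ring
  · refine (hK.norm_sub_le z x).trans ?_
    gcongr
    obtain ⟨t, ht, rfl⟩ := (segment_eq_image' ℝ x y ▸ hz)
    simp only [add_sub_cancel_left, norm_smul, Real.norm_eq_abs, abs_of_nonneg ht.1]
    exact mul_le_of_le_one_left (norm_nonneg _) ht.2

end Cb

section Superposition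

variable {K E F : Type} [TopologicalSpace K] [CompactSpace K] [NormedAddCommGroup E]
  [NormedSpace ℝ E] [NormedAddCommGroup F] [NormedSpace ℝ F]

/-- The superposition (Nemytskii) operator `u ↦ a ∘ u` on continuous maps. -/
def superpose (a : E → F) (ha : Continuous a) (u : C(K, E)) : C(K, F) :=
  (⟨a, ha⟩ : C(E, F)).comp u

@[simp] lemma superpose_apply (a : E → F) (ha : Continuous a) (u : C(K, E)) (s : K) :
    superpose a ha u s = a (u s) := rfl

/-- Pointwise application of a continuous family of operators to a continuous map. -/
def pointwiseApply : C(K, E →L[ℝ] F) →L[ℝ] C(K, E) →L[ℝ] C(K, F) :=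
  LinearMap.mkContinuous₂
    (LinearMap.mk₂ ℝ (fun (A : C(K, E →L[ℝ] F)) (h : C(K, E)) => (⟨fun s => A s (h s), by fun_prop⟩ : C(K, F)))
      (fun _ _ _ => by ext; simp) (fun _ _ _ => by ext; simp) (fun _ _ _ => by ext; simp)
      (fun _ _ _ => by ext; simp)) 1
    (fun A h => by
      rw [ContinuousMap.norm_le _ (by positivity)]
      intro s
      simp only [LinearMap.mk₂_apply, ContinuousMap.coe_mk, one_mul]
      exact (A s).le_of_opNorm_le_of_le (A.norm_coe_le_norm s) (h.norm_coe_le_norm s))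

@[simp] lemma pointwiseApply_apply (A : C(K, E →L[ℝ] F)) (h : C(K, E)) (s : K) :
    pointwiseApply A h s = A s (h s) := rfl

lemma IsCb.hasFDerivAt_superpose {a : E → F} (ha : IsCb a) (u : C(K, E)) :
    HasFDerivAt (superpose a ha.1.continuous)
      (pointwiseApply (superpose (_root_.fderiv ℝ a) ha.fderiv.1.continuous u)) u := by
  obtain ⟨C, hC0, hC⟩ := ha.quadratic_remainder
  rw [hasFDerivAt_iff_isLittleO]
  refine Asymptotics.IsBigO.trans_isLittleO (g := fun v => ‖v - u‖ ^ 2) ?_ ?_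
  · refine Asymptotics.IsBigO.of_bound C (Filter.Eventually.of_forall fun v => ?_)
    rw [ContinuousMap.norm_le _ (by positivity)]
    intro s
    change ‖a (v s) - a (u s) - _root_.fderiv ℝ a (u s) (v s - u s)‖ ≤ _
    refine (hC (u s) (v s)).trans ?_
    simp only [norm_pow, norm_norm]
    gcongr
    exact (v - u).norm_coe_le_norm s
  · exact Asymptotics.isLittleO_pow_sub_sub u one_lt_two

lemma IsCb.contDiff_superpose {a : E → F} (ha : IsCb a) :
    ContDiff ℝ (⊤ : ℕ∞) (superpose (K := K) a ha.1.continuous) := by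
  rw [contDiff_infty]
  intro n
  induction n generalizing F with
  | zero => exact contDiff_zero.2 (ContinuousMap.continuous_postcomp _)
  | succ n ih =>
    exact contDiff_succ_iff_hasFDerivAt.2
      ⟨_, pointwiseApply.contDiff.comp (ih ha.fderiv), ha.hasFDerivAt_superpose⟩

end Superposition

section FlowExistence

variable {E : Type} [NormedAddCommGroup E] [NormedSpace ℝ E] [CompleteSpace E]

/-- A bounded Lipschitz vector field has a global integral curve through every point. -/
lemma exists_global_integralCurve {a : E → E} {K : NNReal} (hK : LipschitzWith K a) {M : ℝ}
    (hM : ∀ x, ‖a x‖ ≤ M) (x : E) :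
    ∃ α : ℝ → E, α 0 = x ∧ ∀ t, HasDerivAt α (a (α t)) t := by
  have hM0 : 0 ≤ M := (norm_nonneg _).trans (hM x)
  have key : ∀ n : ℕ, ∃ α : ℝ → E, α 0 = x ∧
      ∀ t ∈ Set.Ioo (-(n + 1 : ℝ)) (n + 1), HasDerivAt α (a (α t)) t := by
    intro n
    have hn : (0 : ℝ) ≤ n := Nat.cast_nonneg n
    have hPL : IsPicardLindelof (fun _ => a) (tmin := -(n + 1 : ℝ)) (tmax := n + 1)
        ⟨0, by constructor <;> linarith⟩ x ⟨M * (n + 1), by positivity⟩ 0 ⟨M, hM0⟩ K := by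
      refine IsPicardLindelof.of_time_independent (fun y _ => hM y) hK.lipschitzOnWith ?_
      simp only [sub_zero, zero_sub, neg_neg, max_self, NNReal.coe_zero]
      exact le_rfl
    obtain ⟨α, h0, hα⟩ := hPL.exists_eq_forall_mem_Icc_hasDerivWithinAt₀
    exact ⟨α, h0, fun t ht => (hα t (Set.Ioo_subset_Icc_self ht)).hasDerivAt
      (Icc_mem_nhds ht.1 ht.2)⟩
  choose α h0 hα using key
  have huniq : ∀ m n : ℕ, m ≤ n → ∀ t ∈ Set.Ioo (-(m + 1 : ℝ)) (m + 1), α m t = α n t := by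
    intro m n hmn t ht
    have hmn' : (m : ℝ) ≤ n := by exact_mod_cast hmn
    have hm : (0 : ℝ) ≤ m := Nat.cast_nonneg m
    refine ODE_solution_unique_of_mem_Ioo (v := fun _ => a) (s := fun _ => Set.univ) (t₀ := 0)
      (K := K) (fun _ _ => hK.lipschitzOnWith) (by constructor <;> linarith)
      (fun s hs => ⟨hα m s hs, trivial⟩) (fun s hs => ⟨hα n s ⟨by linarith [hs.1],
        by linarith [hs.2]⟩, trivial⟩) (by rw [h0, h0]) ht
  refine ⟨fun t => α ⌈|t|⌉₊ t, by simp [h0], fun t => ?_⟩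
  set N := ⌈|t|⌉₊ + 1 with hN
  have hlt : |t| < N := by
    have := Nat.le_ceil |t|
    push_cast [hN]; linarith
  have heq : ∀ s : ℝ, |s| < N → α ⌈|s|⌉₊ s = α N s := by
    intro s hs
    have h1 := Nat.le_ceil |s|
    refine huniq _ _ (Nat.ceil_le.2 hs.le) s ?_
    rw [Set.mem_Ioo, ← abs_lt]; linarith
  have hd : HasDerivAt (α N) (a (α N t)) t := by
    apply hα
    rw [Set.mem_Ioo, ← abs_lt]; linarith
  have := hd.congr_of_eventuallyEq (f₁ := fun t => α ⌈|t|⌉₊ t) (by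
    filter_upwards [(continuous_abs.isOpen_preimage _ isOpen_Iio).mem_nhds hlt] with s hs
    exact heq s hs)
  rwa [← heq t hlt] at this

end FlowExistence

section FlowSmooth

open unitInterval

variable {E : Type} [NormedAddCommGroup E] [NormedSpace ℝ E]

lemma flow_add {a : E → E} {K : NNReal} (hK : LipschitzWith K a) {f : ℝ → E → E}
    (h0 : ∀ x, f 0 x = x) (hf : ∀ t x, HasDerivAt (fun s => f s x) (a (f t x)) t)
    (s t : ℝ) (x : E) : f (s + t) x = f s (f t x) := by
  have := ODE_solution_unique_univ (v := fun _ => a) (s := fun _ => Set.univ) (t₀ := 0) (K := K)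
    (f := fun s => f (s + t) x) (g := fun s => f s (f t x)) (fun _ => hK.lipschitzOnWith)
    (fun s => ⟨(hf (s + t) x).comp_add_const s t, trivial⟩) (fun s => ⟨hf s _, trivial⟩)
    (by simp [h0])
  exact congrFun this s

/-- Integration from the left end point, as an operator on `C([0,1], E)`. -/
def integralOp : C(I, E) →L[ℝ] C(I, E) :=
  LinearMap.mkContinuous
    { toFun := fun w => ⟨fun s => ∫ r in (0 : ℝ)..s, Set.IccExtend zero_le_one w r, by
        have h : Continuous (Set.IccExtend (zero_le_one' ℝ) w) := w.continuous.Icc_extend'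
        exact (intervalIntegral.continuous_primitive (fun _ _ => h.intervalIntegrable _ _) 0).comp
          continuous_subtype_val⟩
      map_add' := fun v w => by
        ext s
        have hv : Continuous (Set.IccExtend (zero_le_one' ℝ) v) := v.continuous.Icc_extend'
        have hw : Continuous (Set.IccExtend (zero_le_one' ℝ) w) := w.continuous.Icc_extend'
        exact intervalIntegral.integral_add (hv.intervalIntegrable _ _) (hw.intervalIntegrable _ _)
      map_smul' := fun c w => by
        ext s
        exact intervalIntegral.integral_smul c _ } 1
    (fun w => by
      rw [ContinuousMap.norm_le _ (by positivity)]
      intro s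
      refine (intervalIntegral.norm_integral_le_of_norm_le_const (C := ‖w‖)
        (fun r _ => w.norm_coe_le_norm _)).trans ?_
      rw [sub_zero, abs_of_nonneg s.2.1, one_mul]
      exact mul_le_of_le_one_right (norm_nonneg _) s.2.2)

lemma integralOp_apply (w : C(I, E)) (s : I) :
    integralOp w s = ∫ r in (0 : ℝ)..s, Set.IccExtend zero_le_one w r := rfl

lemma norm_integralOp_apply_le (w : C(I, E)) : ‖integralOp w‖ ≤ ‖w‖ := by
  have h : ‖(integralOp : C(I, E) →L[ℝ] C(I, E))‖ ≤ 1 :=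
    LinearMap.mkContinuous_norm_le _ zero_le_one _
  simpa using ContinuousLinearMap.le_of_opNorm_le _ h w

/-- The defect in the time-rescaled integral equation for the flow of `a`. -/
def flowDefect (a : E → E) (ha : Continuous a) (p : (ℝ × E) × C(I, E)) : C(I, E) :=
  p.2 - ContinuousLinearMap.const ℝ I p.1.2 - p.1.1 • integralOp (superpose a ha p.2)

lemma flowDefect_unique {a : E → E} {K : NNReal} (hK : LipschitzWith K a) {q : ℝ × E}
    (hq : |q.1| * K < 1) {u v : C(I, E)} (hu : flowDefect a hK.continuous (q, u) = 0)
    (hv : flowDefect a hK.continuous (q, v) = 0) : u = v := by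
  have h : u - v = q.1 • integralOp
      (superpose a hK.continuous u - superpose a hK.continuous v) := by
    have := hu.trans hv.symm
    simp only [flowDefect] at this
    rw [map_sub, smul_sub]
    rw [sub_right_comm, sub_eq_iff_eq_add, sub_right_comm v, ← sub_eq_iff_eq_add] at this
    rw [← sub_eq_zero] at this ⊢
    rw [← this]
    abel
  have h2 : ‖superpose a hK.continuous u - superpose a hK.continuous v‖ ≤ K * ‖u - v‖ := by
    rw [ContinuousMap.norm_le _ (by positivity)]
    intro s
    refine (hK.norm_sub_le (u s) (v s)).trans ?_
    gcongr
    exact (u - v).norm_coe_le_norm s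
  have h3 : ‖u - v‖ ≤ (|q.1| * K) * ‖u - v‖ := by
    conv_lhs => rw [h, norm_smul, Real.norm_eq_abs]
    rw [mul_assoc]
    gcongr
    exact (norm_integralOp_apply_le _).trans h2
  have h4 : ‖u - v‖ ≤ 0 := by nlinarith [norm_nonneg (u - v)]
  exact sub_eq_zero.1 (norm_le_zero_iff.1 h4)

lemma flowDefect_flow [CompleteSpace E] {a : E → E} (ha : Continuous a) {f : ℝ → E → E}
    (h0 : ∀ x, f 0 x = x) (hf : ∀ t x, HasDerivAt (fun s => f s x) (a (f t x)) t)
    (q : ℝ × E) (u : C(I, E)) (hu : ∀ s : I, u s = f (q.1 * s) q.2) :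
    flowDefect a ha (q, u) = 0 := by
  have hc : Continuous fun r : ℝ => f (q.1 * r) q.2 :=
    (continuous_iff_continuousAt.2 fun t => (hf t q.2).continuousAt).comp
      (continuous_const.mul continuous_id)
  ext s
  have h1 : ∫ r in (0 : ℝ)..s, q.1 • a (f (q.1 * r) q.2) = f (q.1 * s) q.2 - f (q.1 * 0) q.2 := by
    refine intervalIntegral.integral_eq_sub_of_hasDerivAt (f := fun r => f (q.1 * r) q.2)
      (fun r _ => ?_) ((continuous_const.smul (ha.comp hc)).intervalIntegrable _ _)
    have := (hf (q.1 * r) q.2).scomp r ((hasDerivAt_id r).const_mul q.1)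
    simpa using! this
  have h2 : ∫ r in (0 : ℝ)..s, Set.IccExtend zero_le_one (superpose a ha u) r =
      ∫ r in (0 : ℝ)..s, a (f (q.1 * r) q.2) := by
    refine intervalIntegral.integral_congr fun r hr => ?_
    rw [Set.uIcc_of_le s.2.1] at hr
    have hr' : r ∈ I := ⟨hr.1, hr.2.trans s.2.2⟩
    simp only [Set.IccExtend_of_mem _ _ hr', superpose_apply, hu]
  rw [intervalIntegral.integral_smul] at h1
  simp only [flowDefect, ContinuousMap.sub_apply, ContinuousMap.smul_apply, integralOp_apply, h2,
    h1, hu, mul_zero, h0]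
  simp

lemma IsCb.contDiff_flowDefect {a : E → E} (ha : IsCb a) :
    ContDiff ℝ (⊤ : ℕ∞) (flowDefect a ha.1.continuous) := by
  refine (contDiff_snd.sub
    ((ContinuousLinearMap.const ℝ I : E →L[ℝ] C(I, E)).contDiff.comp (contDiff_snd.comp contDiff_fst))).sub ?_
  exact (contDiff_fst.comp contDiff_fst).smul
    (integralOp.contDiff.comp (ha.contDiff_superpose.comp contDiff_snd))

lemma IsCb.isInvertible_fderiv_flowDefect [CompleteSpace E] {a : E → E} (ha : IsCb a) {K : NNReal}
    (hK : LipschitzWith K a) (p : (ℝ × E) × C(I, E)) (hp : |p.1.1| * K < 1) :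
    (_root_.fderiv ℝ (flowDefect a ha.1.continuous) p ∘L
      .inr ℝ (ℝ × E) C(I, E)).IsInvertible := by
  set B : C(I, E) →L[ℝ] C(I, E) := p.1.1 • (integralOp ∘L
    pointwiseApply (superpose (_root_.fderiv ℝ a) ha.fderiv.1.continuous p.2)) with hB
  have h1 : HasFDerivAt (fun u => flowDefect a ha.1.continuous (p.1, u))
      (_root_.fderiv ℝ (flowDefect a ha.1.continuous) p ∘L .inr ℝ (ℝ × E) C(I, E)) p.2 := by
    have h := (ha.contDiff_flowDefect.differentiable (by simp) p).hasFDerivAt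
    exact HasFDerivAt.comp (g := flowDefect a ha.1.continuous) p.2 h (hasFDerivAt_prodMk_right p.1 p.2)
  have h2 : HasFDerivAt (fun u => flowDefect a ha.1.continuous (p.1, u)) (1 - B) p.2 := by
    exact ((hasFDerivAt_id p.2).sub_const (ContinuousLinearMap.const ℝ I p.1.2)).sub
      ((integralOp.hasFDerivAt.comp p.2 (ha.hasFDerivAt_superpose p.2)).const_smul p.1.1)
  rw [h1.unique h2]
  have hBn : ‖B‖ ≤ |p.1.1| * K := by
    refine ContinuousLinearMap.opNorm_le_bound _ (by positivity) fun h => ?_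
    simp only [hB, _root_.smul_apply, ContinuousLinearMap.comp_apply, norm_smul,
      Real.norm_eq_abs, mul_assoc]
    gcongr
    refine (norm_integralOp_apply_le _).trans ?_
    rw [ContinuousMap.norm_le _ (by positivity)]
    intro s
    exact ContinuousLinearMap.le_of_opNorm_le_of_le _ (norm_fderiv_le_of_lipschitz ℝ hK)
      (h.norm_coe_le_norm s)
  obtain ⟨U, hU⟩ := isUnit_one_sub_of_norm_lt_one (R := C(I, E) →L[ℝ] C(I, E)) (x := B) (hBn.trans_lt hp)
  rw [← hU]
  exact ⟨ContinuousLinearEquiv.unitsEquiv ℝ _ U, rfl⟩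

/-- The flow of a smooth vector field with bounded derivatives is jointly smooth. -/
lemma IsCb.contDiff_flow [CompleteSpace E] {a : E → E} (ha : IsCb a) {f : ℝ → E → E}
    (h0 : ∀ x, f 0 x = x) (hf : ∀ t x, HasDerivAt (fun s => f s x) (a (f t x)) t) :
    ContDiff ℝ (⊤ : ℕ∞) (fun p : ℝ × E => f p.1 p.2) := by
  obtain ⟨K, hK⟩ := ha.lipschitz
  have hn : ((⊤ : ℕ∞) : WithTop ℕ∞) ≠ 0 := by simp
  have hsmall : ∀ q : ℝ × E, |q.1| * K < 1 →
      ContDiffAt ℝ (⊤ : ℕ∞) (fun p : ℝ × E => f p.1 p.2) q := by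
    intro q hq
    have hcont : ∀ p : ℝ × E, Continuous fun s : I => f (p.1 * s) p.2 := fun p =>
      (continuous_iff_continuousAt.2 fun t => (hf t p.2).continuousAt).comp
        (continuous_const.mul continuous_subtype_val)
    let c : ℝ × E → C(I, E) := fun p => ⟨fun s => f (p.1 * s) p.2, hcont p⟩
    have hc : ∀ p, flowDefect a ha.1.continuous (p, c p) = 0 := fun p =>
      flowDefect_flow _ h0 hf p _ fun s => rfl
    have hF : ContDiffAt ℝ (⊤ : ℕ∞) (flowDefect a ha.1.continuous) (q, c q) :=
      ha.contDiff_flowDefect.contDiffAt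
    have hinv := ha.isInvertible_fderiv_flowDefect hK (q, c q) hq
    have hψ := hF.contDiffAt_implicitFunction hn hinv
    have hcs : ContDiffAt ℝ (⊤ : ℕ∞) c q := by
      refine hψ.congr_of_eventuallyEq ?_
      have hopen : ∀ᶠ p : ℝ × E in nhds q, |p.1| * K < 1 :=
        (((continuous_abs.comp continuous_fst).mul continuous_const).isOpen_preimage _
          isOpen_Iio).mem_nhds hq
      filter_upwards [hF.eventually_apply_implicitFunction hn hinv, hopen] with p hp hpK
      exact flowDefect_unique hK hpK (hc p) (hp.trans (hc q))
    have := (ContinuousMap.evalCLM (M := E) ℝ (1 : I)).contDiff.contDiffAt.comp q hcs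
    refine this.congr_of_eventuallyEq (Filter.Eventually.of_forall fun p => ?_)
    simp [c]
  have hall : ∀ k : ℕ, ∀ q : ℝ × E, |q.1| * K < 2 ^ k →
      ContDiffAt ℝ (⊤ : ℕ∞) (fun p : ℝ × E => f p.1 p.2) q := by
    intro k
    induction k with
    | zero => simpa using hsmall
    | succ k ih =>
      intro q hq
      have hq' : |q.1 / 2| * K < 2 ^ k := by
        rw [abs_div, abs_two]; rw [pow_succ] at hq; linarith
      have hhalf : ContDiffAt ℝ (⊤ : ℕ∞) (fun p : ℝ × E => (p.1 / 2, p.2)) q := by fun_prop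
      have hhalf1 : ContDiffAt ℝ (⊤ : ℕ∞) (fun p : ℝ × E => p.1 / 2) q := by fun_prop
      have h1 : ContDiffAt ℝ (⊤ : ℕ∞) (fun p : ℝ × E => f (p.1 / 2) p.2) q :=
        by
        exact ContDiffAt.comp (f := fun p : ℝ × E => (p.1 / 2, p.2)) q
          (ih (q.1 / 2, q.2) hq') hhalf
      have h2 := (ih (q.1 / 2, f (q.1 / 2) q.2) hq').comp q (hhalf1.prodMk h1)
      refine h2.congr_of_eventuallyEq (Filter.Eventually.of_forall fun p => ?_)
      simp only [Function.comp]
      rw [← flow_add hK h0 hf, add_halves]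
  rw [contDiff_iff_contDiffAt]
  intro q
  obtain ⟨k, hk⟩ := pow_unbounded_of_one_lt (|q.1| * K) one_lt_two
  exact hall k q hk

end FlowSmooth

lemma IsCbVF.isCb {a : Ec d → Ec d} (ha : IsCbVF a) : IsCb a := ha

/-- Every `C_b^∞`-vector field has a smooth global flow. -/
lemma IsCbVF.exists_isFlowOf {a : Ec d → Ec d} (ha : IsCbVF a) : ∃ f, IsFlowOf a f := by
  obtain ⟨K, hK⟩ := ha.isCb.lipschitz
  obtain ⟨M, -, hM⟩ := ha.isCb.bounded
  choose α h0 hα using exists_global_integralCurve hK hM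
  exact ⟨fun t x => α x t, ha.isCb.contDiff_flow h0 fun t x => hα x t, h0, fun t x => hα x t⟩

section LieSpan

lemma IsCbVF.vfComm {a b : Ec d → Ec d} (ha : IsCbVF a) (hb : IsCbVF b) :
    IsCbVF (vfComm a b) :=
  IsCb.sub (hb.isCb.fderiv.clm_apply ha.isCb) (ha.isCb.fderiv.clm_apply hb.isCb)

lemma vfComm_zero_left (b : Ec d → Ec d) : vfComm 0 b = 0 := by
  ext1 x; simp [vfComm]

lemma vfComm_zero_right (a : Ec d → Ec d) : vfComm a 0 = 0 := by
  ext1 x; simp [vfComm]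

lemma vfComm_add_left {a a' : Ec d → Ec d} (b : Ec d → Ec d) (ha : IsCbVF a) (ha' : IsCbVF a') :
    vfComm (a + a') b = vfComm a b + vfComm a' b := by
  ext1 x
  exact VectorField.lieBracket_add_left (ha.isCb.differentiable x) (ha'.isCb.differentiable x)

lemma vfComm_add_right (a : Ec d → Ec d) {b b' : Ec d → Ec d} (hb : IsCbVF b) (hb' : IsCbVF b') :
    vfComm a (b + b') = vfComm a b + vfComm a b' := by
  ext1 x
  exact VectorField.lieBracket_add_right (hb.isCb.differentiable x) (hb'.isCb.differentiable x)

lemma vfComm_smul_left {a : Ec d → Ec d} (b : Ec d → Ec d) (c : ℝ) (ha : IsCbVF a) :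
    vfComm (c • a) b = c • vfComm a b := by
  ext1 x
  exact VectorField.lieBracket_const_smul_left (ha.isCb.differentiable x)

lemma vfComm_smul_right (a : Ec d → Ec d) {b : Ec d → Ec d} (c : ℝ) (hb : IsCbVF b) :
    vfComm a (c • b) = c • vfComm a b := by
  ext1 x
  exact VectorField.lieBracket_const_smul_right (hb.isCb.differentiable x)

lemma vfComm_jacobi {a b c : Ec d → Ec d} (ha : IsCbVF a) (hb : IsCbVF b) (hc : IsCbVF c) :
    vfComm (vfComm a b) c = vfComm a (vfComm b c) - vfComm b (vfComm a c) := by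
  have hn : minSmoothness ℝ 2 ≤ ((⊤ : ℕ∞) : WithTop ℕ∞) := by
    rw [minSmoothness_of_isRCLikeNormedField]
    exact WithTop.coe_le_coe.2 (le_top : (2 : ℕ∞) ≤ ⊤)
  rw [eq_sub_iff_add_eq]
  ext1 x
  exact (VectorField.leibniz_identity_lieBracket hn ha.1.contDiffAt hb.1.contDiffAt
    hc.1.contDiffAt).symm

variable {ι : Type*}

lemma isCbVF_multiComm {Y : ι → Ec d → Ec d} (hY : ∀ i, IsCbVF (Y i)) (l : List ι) :
    IsCbVF (multiComm Y l) := by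
  induction l with
  | nil => exact IsCb.zero
  | cons i l ih =>
    cases l with
    | nil => exact hY i
    | cons j l => exact (hY i).vfComm ih

/-- The real linear span of the iterated commutators of length `n`. -/
def lieSpan (Y : ι → Ec d → Ec d) (n : ℕ) : Submodule ℝ (Ec d → Ec d) :=
  Submodule.span ℝ (Set.range fun v : Fin n → ι => multiComm Y (List.ofFn v))

lemma multiComm_mem_lieSpan (Y : ι → Ec d → Ec d) (l : List ι) {n : ℕ} (hn : l.length = n) :
    multiComm Y l ∈ lieSpan Y n := by
  subst hn
  exact Submodule.subset_span ⟨l.get, by simp [List.ofFn_get]⟩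

lemma isCbVF_of_mem_lieSpan {Y : ι → Ec d → Ec d} (hY : ∀ i, IsCbVF (Y i)) {n : ℕ}
    {X : Ec d → Ec d} (hX : X ∈ lieSpan Y n) : IsCbVF X := by
  induction hX using Submodule.span_induction with
  | mem x hx => obtain ⟨v, rfl⟩ := hx; exact isCbVF_multiComm hY _
  | zero => exact IsCb.zero
  | add x y _ _ hx hy => exact IsCb.add hx hy
  | smul c x _ hx => exact IsCb.const_smul hx c

lemma vfComm_generator_mem_lieSpan {Y : ι → Ec d → Ec d} (hY : ∀ i, IsCbVF (Y i)) (i : ι) {n : ℕ}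
    {P : Ec d → Ec d} (hP : P ∈ lieSpan Y n) : vfComm (Y i) P ∈ lieSpan Y (n + 1) := by
  induction hP using Submodule.span_induction with
  | mem x hx =>
    obtain ⟨v, rfl⟩ := hx
    cases hv : List.ofFn v with
    | nil =>
      simp only [hv]
      rw [show multiComm Y [] = 0 from rfl, vfComm_zero_right]
      exact zero_mem _
    | cons j l =>
      simp only [hv]
      refine multiComm_mem_lieSpan Y (i :: j :: l) ?_
      rw [← hv]; simp
  | zero => rw [vfComm_zero_right]; exact zero_mem _
  | add x y hx hy h1 h2 =>
    rw [vfComm_add_right _ (isCbVF_of_mem_lieSpan hY hx) (isCbVF_of_mem_lieSpan hY hy)]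
    exact add_mem h1 h2
  | smul c x hx h1 =>
    rw [vfComm_smul_right _ c (isCbVF_of_mem_lieSpan hY hx)]
    exact Submodule.smul_mem _ c h1

lemma vfComm_multiComm_mem_lieSpan {Y : ι → Ec d → Ec d} (hY : ∀ i, IsCbVF (Y i)) (l : List ι)
    {n : ℕ} {P : Ec d → Ec d} (hP : P ∈ lieSpan Y n) :
    vfComm (multiComm Y l) P ∈ lieSpan Y (l.length + n) := by
  induction l generalizing n P with
  | nil =>
    rw [show multiComm Y [] = 0 from rfl, vfComm_zero_left]
    exact zero_mem _
  | cons i l ih =>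
    cases l with
    | nil =>
      rw [List.length_singleton, add_comm]
      exact vfComm_generator_mem_lieSpan hY i hP
    | cons j l =>
      rw [show multiComm Y (i :: j :: l) = vfComm (Y i) (multiComm Y (j :: l)) from rfl,
        vfComm_jacobi (hY i) (isCbVF_multiComm hY _) (isCbVF_of_mem_lieSpan hY hP)]
      refine sub_mem ?_ ?_
      · have := vfComm_generator_mem_lieSpan hY i (ih hP)
        rwa [add_right_comm] at this
      · have := ih (vfComm_generator_mem_lieSpan hY i hP)
        rwa [← add_assoc, add_right_comm] at this

lemma vfComm_mem_lieSpan {Y : ι → Ec d → Ec d} (hY : ∀ i, IsCbVF (Y i)) {m n : ℕ}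
    {X P : Ec d → Ec d} (hX : X ∈ lieSpan Y m) (hP : P ∈ lieSpan Y n) :
    vfComm X P ∈ lieSpan Y (m + n) := by
  induction hX using Submodule.span_induction with
  | mem x hx =>
    obtain ⟨v, rfl⟩ := hx
    simpa using vfComm_multiComm_mem_lieSpan hY (List.ofFn v) hP
  | zero => rw [vfComm_zero_left]; exact zero_mem _
  | add x y hx hy h1 h2 =>
    rw [vfComm_add_left _ (isCbVF_of_mem_lieSpan hY hx) (isCbVF_of_mem_lieSpan hY hy)]
    exact add_mem h1 h2
  | smul c x hx h1 =>
    rw [vfComm_smul_left _ c (isCbVF_of_mem_lieSpan hY hx)]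
    exact Submodule.smul_mem _ c h1

/-- The iterated adjoint action `(ad X)^l P`. -/
def adIter (X : Ec d → Ec d) (l : ℕ) (P : Ec d → Ec d) : Ec d → Ec d := (vfComm X)^[l] P

lemma adIter_succ (X : Ec d → Ec d) (l : ℕ) (P : Ec d → Ec d) :
    adIter X (l + 1) P = vfComm X (adIter X l P) := Function.iterate_succ_apply' _ _ _

lemma IsCbVF.adIter {X P : Ec d → Ec d} (hX : IsCbVF X) (hP : IsCbVF P) (l : ℕ) :
    IsCbVF (adIter X l P) := by
  induction l with
  | zero => exact hP
  | succ l ih => rw [adIter_succ]; exact hX.vfComm ih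

lemma adIter_mem_lieSpan {Y : ι → Ec d → Ec d} (hY : ∀ i, IsCbVF (Y i)) {m n : ℕ}
    {X P : Ec d → Ec d} (hX : X ∈ lieSpan Y m) (hP : P ∈ lieSpan Y n) (l : ℕ) :
    adIter X l P ∈ lieSpan Y (n + m * l) := by
  induction l with
  | zero => exact hP
  | succ l ih =>
    rw [adIter_succ, show n + m * (l + 1) = m + (n + m * l) by ring]
    exact vfComm_mem_lieSpan hY hX ih

lemma exists_coef_of_mem_lieSpan {Y : Fin 2 → Ec d → Ec d} {n : ℕ} {X : Ec d → Ec d}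
    (hX : X ∈ lieSpan Y n) : ∃ coef : (Fin n → Fin 2) → ℝ,
      X = fun x => ∑ v : Fin n → Fin 2, coef v • multiComm Y (List.ofFn v) x := by
  obtain ⟨c, rfl⟩ := (Submodule.mem_span_range_iff_exists_fun ℝ).1 hX
  exact ⟨c, by ext1 x; simp [Finset.sum_apply]⟩

end LieSpan

section Gronwall

variable {E : Type} [NormedAddCommGroup E] [NormedSpace ℝ E]

lemma gronwallBound_le {δ K ε x : ℝ} (hK : 0 ≤ K) (hε : 0 ≤ ε) :
    gronwallBound δ K ε x ≤ (δ + ε * x) * Real.exp (K * x) := by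
  rcases hK.eq_or_lt with rfl | hK
  · simp [gronwallBound_K0]
  · rw [gronwallBound_of_K_ne_0 hK.ne']
    have h1 : Real.exp (K * x) - 1 ≤ K * x * Real.exp (K * x) := by
      have h := Real.add_one_le_exp (-(K * x))
      have h2 : Real.exp (-(K * x)) * Real.exp (K * x) = 1 := by
        rw [← Real.exp_add]; simp
      nlinarith [Real.exp_pos (K * x)]
    have h2 := mul_le_mul_of_nonneg_left h1 (div_nonneg hε hK.le)
    have h3 : ε / K * (K * x * Real.exp (K * x)) = ε * x * Real.exp (K * x) := by
      field_simp
    dsimp only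
    linarith

lemma norm_le_of_norm_deriv_le_right {u u' : ℝ → E} {K ε t : ℝ} (hK : 0 ≤ K) (hε : 0 ≤ ε)
    (ht0 : 0 ≤ t) (ht : t ≤ 1) (hu : ∀ r, |r| ≤ t → HasDerivAt u (u' r) r)
    (hu' : ∀ r, |r| ≤ t → ‖u' r‖ ≤ K * ‖u r‖ + ε) :
    ‖u t‖ ≤ (‖u 0‖ + ε * t) * Real.exp K := by
  have habs : ∀ r ∈ Set.Icc 0 t, |r| ≤ t := fun r hr => by rw [abs_of_nonneg hr.1]; exact hr.2
  have h := norm_le_gronwallBound_of_norm_deriv_right_le (f := u) (f' := u') (δ := ‖u 0‖) (K := K)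
    (ε := ε) (a := 0) (b := t)
    (fun r hr => (hu r (habs r hr)).continuousAt.continuousWithinAt)
    (fun r hr => (hu r (habs r ⟨hr.1, hr.2.le⟩)).hasDerivWithinAt) le_rfl
    (fun r hr => hu' r (habs r ⟨hr.1, hr.2.le⟩)) t ⟨ht0, le_rfl⟩
  rw [sub_zero] at h
  refine (h.trans (gronwallBound_le hK hε)).trans ?_
  gcongr
  nlinarith

/-- Two-sided Gronwall inequality on `[-1, 1]`. -/
lemma norm_le_of_norm_deriv_le {u u' : ℝ → E} {K ε t : ℝ} (hK : 0 ≤ K) (hε : 0 ≤ ε)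
    (ht : |t| ≤ 1) (hu : ∀ r, |r| ≤ |t| → HasDerivAt u (u' r) r)
    (hu' : ∀ r, |r| ≤ |t| → ‖u' r‖ ≤ K * ‖u r‖ + ε) :
    ‖u t‖ ≤ (‖u 0‖ + ε * |t|) * Real.exp K := by
  rcases le_total 0 t with h | h
  · rw [abs_of_nonneg h] at *
    exact norm_le_of_norm_deriv_le_right hK hε h ht hu hu'
  · rw [abs_of_nonpos h] at *
    have := norm_le_of_norm_deriv_le_right (u := fun r => u (-r)) (u' := fun r => -u' (-r)) hK hε
      (by linarith : 0 ≤ -t) ht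
      (fun r hr => by
        have := (hu (-r) (by rwa [abs_neg])).scomp r (hasDerivAt_neg r)
        rw [neg_one_smul] at this
        exact this)
      (fun r hr => by rw [norm_neg]; exact hu' (-r) (by rwa [abs_neg]))
    simpa using this

end Gronwall

section Variational

variable {E : Type} [NormedAddCommGroup E] [NormedSpace ℝ E]

lemma hasDerivAt_fderiv_of_flow {X : E → E} {G : ℝ → E → E}
    (hG : ContDiff ℝ (⊤ : ℕ∞) (fun p : ℝ × E => G p.1 p.2))
    (hf : ∀ t x, HasDerivAt (fun s => G s x) (X (G t x)) t) (hX : Differentiable ℝ X)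
    (s : ℝ) (y v : E) :
    HasDerivAt (fun s => fderiv ℝ (G s) y v)
      (fderiv ℝ X (G s y) (fderiv ℝ (G s) y v)) s := by
  set F : ℝ × E → E := fun p => G p.1 p.2 with hF
  have hd : Differentiable ℝ F := hG.differentiable (by simp)
  have hd2 : Differentiable ℝ (fderiv ℝ F) :=
    (hG.fderiv_right (m := (⊤ : ℕ∞)) (by simp)).differentiable (by simp)
  have h2 : ∀ s y, fderiv ℝ (G s) y = (fderiv ℝ F (s, y)).comp (.inr ℝ ℝ E) := fun s y =>
    ((hd (s, y)).hasFDerivAt.comp y (hasFDerivAt_prodMk_right s y)).fderiv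
  have h1 : ∀ p : ℝ × E, fderiv ℝ F p (1, 0) = X (F p) := by
    rintro ⟨s, y⟩
    have := (hd (s, y)).hasFDerivAt.comp_hasDerivAt s
      ((hasDerivAt_id s).prodMk (hasDerivAt_const s y))
    exact this.unique (hf s y)
  have h3 : HasDerivAt (fun s => fderiv ℝ (G s) y v)
      (fderiv ℝ (fderiv ℝ F) (s, y) (1, 0) (0, v)) s := by
    have h5 : HasDerivAt (fun s => fderiv ℝ F (s, y)) (fderiv ℝ (fderiv ℝ F) (s, y) (1, 0)) s :=
      (hd2 (s, y)).hasFDerivAt.comp_hasDerivAt s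
        ((hasDerivAt_id s).prodMk (hasDerivAt_const s y))
    have h6 := (ContinuousLinearMap.apply ℝ E ((0 : ℝ), v)).hasFDerivAt.comp_hasDerivAt s h5
    simp only [h2]
    exact h6
  have hsymm := hG.contDiffAt.isSymmSndFDerivAt (x := (s, y)) (by
    rw [minSmoothness_of_isRCLikeNormedField]
    exact WithTop.coe_le_coe.2 (le_top : (2 : ℕ∞) ≤ ⊤)) (1, 0) (0, v)
  have h4 : fderiv ℝ (fderiv ℝ F) (s, y) (0, v) (1, 0)
      = fderiv ℝ X (F (s, y)) (fderiv ℝ F (s, y) (0, v)) := by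
    have e1 : fderiv ℝ (fun p => fderiv ℝ F p (1, 0)) (s, y) (0, v)
        = fderiv ℝ (fderiv ℝ F) (s, y) (0, v) (1, 0) := by
      rw [fderiv_clm_apply (hd2 _) (by fun_prop)]
      simp
    rw [← e1, funext h1, show (fun p => X (F p)) = X ∘ F from rfl,
      fderiv_comp _ (hX _) (hd _)]
    rfl
  rw [hsymm, h4] at h3
  rw [h2]
  exact h3

end Variational

section Pushforward

variable {X P : Ec d → Ec d} {G : ℝ → Ec d → Ec d}

lemma IsFlowOf.norm_sub_le (hG : IsFlowOf X G) {K : NNReal} (hK : LipschitzWith K X) {s : ℝ}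
    (hs : |s| ≤ 1) (x y : Ec d) : ‖G s x - G s y‖ ≤ Real.exp K * ‖x - y‖ := by
  have := norm_le_of_norm_deriv_le (u := fun s => G s x - G s y)
    (u' := fun s => X (G s x) - X (G s y)) (K := K) (ε := 0) K.2 le_rfl hs
    (fun r _ => (hG.2.2 r x).sub (hG.2.2 r y))
    (fun r _ => by rw [add_zero]; exact hK.norm_sub_le _ _)
  simp only [hG.2.1, zero_mul, add_zero] at this
  linarith

lemma IsFlowOf.contDiff (hG : IsFlowOf X G) (s : ℝ) : ContDiff ℝ (⊤ : ℕ∞) (G s) :=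
  hG.1.comp (contDiff_prodMk_right s)

lemma IsFlowOf.lipschitzWith (hG : IsFlowOf X G) {K : NNReal} (hK : LipschitzWith K X) {s : ℝ}
    (hs : |s| ≤ 1) : LipschitzWith ⟨Real.exp K, (Real.exp_pos _).le⟩ (G s) :=
  LipschitzWith.of_dist_le_mul fun x y => by
    rw [dist_eq_norm, dist_eq_norm]; exact hG.norm_sub_le hK hs x y

lemma IsFlowOf.norm_fderiv_le (hG : IsFlowOf X G) {K : NNReal} (hK : LipschitzWith K X) {s : ℝ}
    (hs : |s| ≤ 1) (y : Ec d) : ‖fderiv ℝ (G s) y‖ ≤ Real.exp K :=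
  norm_fderiv_le_of_lipschitz ℝ (hG.lipschitzWith hK hs)

/-- The variational equation of a flow. -/
lemma IsFlowOf.hasDerivAt_fderiv (hG : IsFlowOf X G) (hX : IsCbVF X) (s : ℝ) (y v : Ec d) :
    HasDerivAt (fun s => fderiv ℝ (G s) y v)
      (fderiv ℝ X (G s y) (fderiv ℝ (G s) y v)) s :=
  hasDerivAt_fderiv_of_flow hG.1 hG.2.2 hX.isCb.differentiable s y v

lemma IsFlowOf.hasDerivAt_vf (hG : IsFlowOf X G) {Q : Ec d → Ec d} (hQ : IsCbVF Q) (s : ℝ)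
    (y : Ec d) : HasDerivAt (fun s => Q (G s y))
      (vfComm X Q (G s y) + fderiv ℝ X (G s y) (Q (G s y))) s := by
  have := (hQ.isCb.differentiable (G s y)).hasFDerivAt.comp_hasDerivAt s (hG.2.2 s y)
  rw [vfComm, sub_add_cancel]
  exact this

lemma IsFlowOf.hasDerivAt_sum_adIter (hG : IsFlowOf X G) (hX : IsCbVF X) (hP : IsCbVF P) (L : ℕ)
    (s : ℝ) (y : Ec d) :
    HasDerivAt (fun s => ∑ l ∈ range (L + 1), ((-s) ^ l / (l.factorial : ℝ)) • adIter X l P (G s y))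
      (fderiv ℝ X (G s y)
          (∑ l ∈ range (L + 1), ((-s) ^ l / (l.factorial : ℝ)) • adIter X l P (G s y))
        + ((-s) ^ L / (L.factorial : ℝ)) • adIter X (L + 1) P (G s y)) s := by
  induction L with
  | zero => simpa [adIter, add_comm] using hG.hasDerivAt_vf hP s y
  | succ L ih =>
    simp only [sum_range_succ _ (L + 1)]
    have h1 : HasDerivAt (fun s : ℝ => (-s) ^ (L + 1) / ((L + 1).factorial : ℝ))
        (-((-s) ^ L / (L.factorial : ℝ))) s := by
      have := ((hasDerivAt_neg s).pow (L + 1)).div_const ((L + 1).factorial : ℝ)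
      refine this.congr_deriv ?_
      rw [Nat.factorial_succ]
      push_cast
      have : (L.factorial : ℝ) ≠ 0 := by positivity
      field_simp
    have h2 := h1.smul (hG.hasDerivAt_vf (hX.adIter hP (L + 1)) s y)
    refine (ih.add h2).congr_deriv ?_
    rw [← adIter_succ, map_add, map_smul]
    module

/-- Taylor expansion of the push-forward of a vector field along a flow. -/
lemma IsFlowOf.norm_fderiv_sub_sum_adIter_le (hG : IsFlowOf X G) (hX : IsCbVF X) (hP : IsCbVF P)
    (L : ℕ) : ∃ C : ℝ, 0 ≤ C ∧ ∀ (s : ℝ) (y : Ec d), |s| ≤ 1 →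
      ‖fderiv ℝ (G s) y (P y)
        - ∑ l ∈ range (L + 1), ((-s) ^ l / (l.factorial : ℝ)) • adIter X l P (G s y)‖
        ≤ C * |s| ^ (L + 1) := by
  obtain ⟨K, hK0, hK⟩ := hX.isCb.fderiv.bounded
  obtain ⟨M, hM0, hM⟩ := (hX.adIter hP (L + 1)).isCb.bounded
  refine ⟨M * Real.exp K, by positivity, fun s y hs => ?_⟩
  have := norm_le_of_norm_deriv_le (K := K) (ε := |s| ^ L * M) hK0 (by positivity) hs
    (fun r _ => (hG.hasDerivAt_fderiv hX r y (P y)).sub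
      (hG.hasDerivAt_sum_adIter hX hP L r y))
    (fun r hr => by
      rw [← sub_sub, ← map_sub]
      refine (_root_.norm_sub_le _ _).trans (add_le_add ?_ ?_)
      · exact (ContinuousLinearMap.le_opNorm _ _).trans
          (mul_le_mul_of_nonneg_right (hK _) (norm_nonneg _))
      · rw [norm_smul, norm_div, norm_pow, norm_neg, Real.norm_eq_abs, Real.norm_natCast]
        refine mul_le_mul ?_ (hM _) (norm_nonneg _) (by positivity)
        refine (div_le_self (by positivity) (by exact_mod_cast L.factorial_pos)).trans ?_
        gcongr)
  refine this.trans (le_of_eq ?_)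
  have h0 : G 0 = id := funext hG.2.1
  simp only [Pi.sub_apply, h0, sum_range_succ', fderiv_id]
  simp [adIter]
  ring

end Pushforward

section Expansion

/-- The velocity of the curves `t ↦ Ψ t x` is `∑_{m<N} t^m P_m(Ψ t x)` up to an error of order
`t^N`, where `P_m` is a combination of commutators of length `m + 1`. -/
structure IsApproxFlow (Y : Fin 2 → Ec d → Ec d) (N : ℕ) (Ψ : ℝ → Ec d → Ec d)
    (P : ℕ → Ec d → Ec d) : Prop where
  map_zero : ∀ x, Ψ 0 x = x
  mem_lieSpan : ∀ m, P m ∈ lieSpan Y (m + 1)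
  hasDerivAt : ∃ C : ℝ, 0 ≤ C ∧ ∀ t x, |t| ≤ 1 → ∃ v, HasDerivAt (fun s => Ψ s x) v t ∧
    ‖v - ∑ m ∈ range N, t ^ m • P m (Ψ t x)‖ ≤ C * |t| ^ N

lemma isApproxFlow_id (Y : Fin 2 → Ec d → Ec d) (N : ℕ) :
    IsApproxFlow Y N (fun _ x => x) (fun _ => 0) :=
  ⟨fun _ => rfl, fun _ => zero_mem _, 0, le_rfl, fun t x _ =>
    ⟨0, hasDerivAt_const t x, by simp⟩⟩

/-- The velocity coefficients of `t ↦ exp(t^n X) ∘ Ψ_t` in terms of those of `Ψ`. -/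
def nextCoef (N n : ℕ) (X : Ec d → Ec d) (P : ℕ → Ec d → Ec d) (k : ℕ) : Ec d → Ec d :=
  (if k + 1 = n then (n : ℝ) • X else 0) +
    ∑ m ∈ range N, ∑ l ∈ range (N + 1),
      if m + n * l = k then ((-1 : ℝ) ^ l / (l.factorial : ℝ)) • adIter X l (P m) else 0

lemma nextCoef_mem_lieSpan {Y : Fin 2 → Ec d → Ec d} (hY : ∀ i, IsCbVF (Y i)) {N n : ℕ}
    {X : Ec d → Ec d} (hX : X ∈ lieSpan Y n) {P : ℕ → Ec d → Ec d}
    (hP : ∀ m, P m ∈ lieSpan Y (m + 1)) (k : ℕ) : nextCoef N n X P k ∈ lieSpan Y (k + 1) := by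
  refine add_mem ?_ (sum_mem fun m _ => sum_mem fun l _ => ?_)
  · split_ifs with h
    · rw [h]; exact Submodule.smul_mem _ _ hX
    · exact zero_mem _
  · split_ifs with h
    · refine Submodule.smul_mem _ _ ?_
      rw [← h, add_right_comm]
      exact adIter_mem_lieSpan hY hX (hP m) l
    · exact zero_mem _

lemma nextCoef_of_lt {N n k : ℕ} (X : Ec d → Ec d) (P : ℕ → Ec d → Ec d) (hk : k < N)
    (hkn : k < n) : nextCoef N n X P k = (if k + 1 = n then (n : ℝ) • X else 0) + P k := by
  rw [nextCoef]
  congr 1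
  rw [sum_eq_single k]
  · rw [sum_eq_single 0]
    · simp [adIter]
    · intro l _ hl
      have : n * 1 ≤ n * l := Nat.mul_le_mul_left n (Nat.one_le_iff_ne_zero.2 hl)
      rw [if_neg (by omega)]
    · simp
  · intro m _ hm
    refine sum_eq_zero fun l _ => if_neg fun h => ?_
    rcases Nat.eq_zero_or_pos l with rfl | hl
    · simp at h; exact hm h
    · have : n * 1 ≤ n * l := Nat.mul_le_mul_left n hl
      omega
  · intro h; simp at h; omega

lemma sum_pow_smul_nextCoef {N n : ℕ} (hn : 1 ≤ n) (hnN : n ≤ N) (X : Ec d → Ec d)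
    (P : ℕ → Ec d → Ec d) (t : ℝ) (z : Ec d) :
    ∑ k ∈ range N, t ^ k • nextCoef N n X P k z = (n * t ^ (n - 1)) • X z +
      ∑ m ∈ range N, ∑ l ∈ range (N + 1), if m + n * l < N then
        (t ^ (m + n * l) * ((-1 : ℝ) ^ l / (l.factorial : ℝ))) • adIter X l (P m) z else 0 := by
  simp only [nextCoef, Pi.add_apply, smul_add, sum_add_distrib, Finset.sum_apply, smul_sum]
  congr 1
  · rw [sum_eq_single (n - 1)]
    · rw [if_pos (by omega), Pi.smul_apply, smul_smul, mul_comm]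
    · intro k _ hk
      rw [if_neg (by omega)]; simp
    · intro h; simp at h; omega
  · rw [sum_comm]
    refine sum_congr rfl fun m _ => ?_
    rw [sum_comm]
    refine sum_congr rfl fun l _ => ?_
    split_ifs with h
    · rw [sum_eq_single (m + n * l)]
      · rw [if_pos rfl, Pi.smul_apply, smul_smul]
      · intro k _ hk
        rw [if_neg (Ne.symm hk)]; simp
      · intro h'; exact absurd (mem_range.2 h) h'
    · refine sum_eq_zero fun k hk => ?_
      rw [if_neg (by rintro rfl; exact h (mem_range.1 hk))]; simp

/-- Terms of order at least `N` in the expansion of the push-forward are negligible. -/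
lemma norm_sum_sub_sum_le {N n : ℕ} {X : Ec d → Ec d} {P : ℕ → Ec d → Ec d} (hX : IsCbVF X)
    (hP : ∀ m, IsCbVF (P m)) : ∃ C : ℝ, 0 ≤ C ∧ ∀ (t : ℝ) (z : Ec d), |t| ≤ 1 →
      ‖(∑ m ∈ range N, t ^ m • ∑ l ∈ range (N + 1),
          ((-t ^ n) ^ l / (l.factorial : ℝ)) • adIter X l (P m) z) -
        ∑ m ∈ range N, ∑ l ∈ range (N + 1), (if m + n * l < N then
          (t ^ (m + n * l) * ((-1 : ℝ) ^ l / (l.factorial : ℝ))) • adIter X l (P m) z else 0)‖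
        ≤ C * |t| ^ N := by
  choose M hM0 hM using fun m l => (hX.adIter (hP m) l).isCb.bounded
  refine ⟨∑ m ∈ range N, ∑ l ∈ range (N + 1), M m l,
    sum_nonneg fun m _ => sum_nonneg fun l _ => hM0 m l, fun t z ht => ?_⟩
  simp only [smul_sum, ← sum_sub_distrib, sum_mul]
  refine norm_sum_le_of_le _ fun m _ => norm_sum_le_of_le _ fun l _ => ?_
  have e : t ^ m • ((-t ^ n) ^ l / (l.factorial : ℝ)) • adIter X l (P m) z =
      (t ^ (m + n * l) * ((-1 : ℝ) ^ l / (l.factorial : ℝ))) • adIter X l (P m) z := by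
    rw [smul_smul, neg_pow (t ^ n), ← pow_mul, pow_add]
    congr 1
    ring
  rw [e]
  split_ifs with h
  · rw [sub_self, norm_zero]; have := hM0 m l; positivity
  · rw [sub_zero, norm_smul, mul_comm (M m l)]
    refine mul_le_mul ?_ (hM m l z) (norm_nonneg _) (by positivity)
    rw [norm_mul, norm_div, norm_pow, norm_pow, norm_neg, norm_one, one_pow, Real.norm_eq_abs,
      Real.norm_natCast]
    have h1 : 1 / (l.factorial : ℝ) ≤ 1 := by
      rw [div_le_one (by positivity)]; exact_mod_cast l.factorial_pos
    calc |t| ^ (m + n * l) * (1 / (l.factorial : ℝ)) ≤ |t| ^ (m + n * l) * 1 := by gcongr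
      _ ≤ |t| ^ N := by
        rw [mul_one]; exact pow_le_pow_of_le_one (abs_nonneg _) ht (not_lt.1 h)

lemma IsApproxFlow.comp {Y : Fin 2 → Ec d → Ec d} (hY : ∀ i, IsCbVF (Y i)) {N n : ℕ}
    {Ψ : ℝ → Ec d → Ec d} {P : ℕ → Ec d → Ec d} (h : IsApproxFlow Y N Ψ P) (hn : 1 ≤ n)
    (hnN : n ≤ N) {X : Ec d → Ec d} {G : ℝ → Ec d → Ec d} (hX : X ∈ lieSpan Y n)
    (hG : IsFlowOf X G) :
    IsApproxFlow Y N (fun t x => G (t ^ n) (Ψ t x)) (nextCoef N n X P) := by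
  have hXb := isCbVF_of_mem_lieSpan hY hX
  have hPb := fun m => isCbVF_of_mem_lieSpan hY (h.mem_lieSpan m)
  refine ⟨fun x => ?_, nextCoef_mem_lieSpan hY hX h.mem_lieSpan, ?_⟩
  · rw [zero_pow (by omega), h.map_zero, hG.2.1]
  obtain ⟨K, hK⟩ := hXb.isCb.lipschitz
  obtain ⟨C₁, hC₁, h₁⟩ := h.hasDerivAt
  choose C₂ hC₂ h₂ using fun m => hG.norm_fderiv_sub_sum_adIter_le hXb (hPb m) N
  obtain ⟨C₃, hC₃, h₃⟩ := norm_sum_sub_sum_le (N := N) (n := n) hXb hPb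
  refine ⟨Real.exp K * C₁ + ∑ m ∈ range N, C₂ m + C₃,
    add_nonneg (add_nonneg (by positivity) (sum_nonneg fun m _ => hC₂ m)) hC₃,
    fun t x ht => ?_⟩
  obtain ⟨v, hv, hvb⟩ := h₁ t x ht
  have htn : |t ^ n| ≤ 1 := by rw [abs_pow]; exact pow_le_one₀ (abs_nonneg _) ht
  have htn' : |t ^ n| ≤ |t| := by
    rw [abs_pow]; exact pow_le_of_le_one (abs_nonneg _) ht (by omega)
  set y := Ψ t x with hy
  set z := G (t ^ n) y with hz
  set D := fderiv ℝ (G (t ^ n)) y with hD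
  refine ⟨(n * t ^ (n - 1)) • X z + D v, ?_, ?_⟩
  · have hd := (hG.1.differentiable (by simp) (t ^ n, y)).hasFDerivAt
    have h2 : D = (fderiv ℝ (fun p : ℝ × Ec d => G p.1 p.2) (t ^ n, y)).comp
        (.inr ℝ ℝ (Ec d)) := (hd.comp y (hasFDerivAt_prodMk_right (t ^ n) y)).fderiv
    have h1 : fderiv ℝ (fun p : ℝ × Ec d => G p.1 p.2) (t ^ n, y) (1, 0) = X z :=
      (hd.comp_hasDerivAt (t ^ n) ((hasDerivAt_id _).prodMk (hasDerivAt_const _ y))).unique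
        (hG.2.2 (t ^ n) y)
    have h3 := hd.comp_hasDerivAt t ((hasDerivAt_pow n t).prodMk hv)
    refine HasDerivAt.congr_deriv h3 ?_
    rw [← h1, h2, ← map_smul, ContinuousLinearMap.comp_apply, ← map_add]
    simp
  · rw [sum_pow_smul_nextCoef hn hnN]
    set S := ∑ m ∈ range N, ∑ l ∈ range (N + 1), (if m + n * l < N then
          (t ^ (m + n * l) * ((-1 : ℝ) ^ l / (l.factorial : ℝ))) • adIter X l (P m) z else 0)
    set R := ∑ m ∈ range N, t ^ m • ∑ l ∈ range (N + 1),
          ((-t ^ n) ^ l / (l.factorial : ℝ)) • adIter X l (P m) z with hR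
    have e : (n * t ^ (n - 1)) • X z + D v - ((n * t ^ (n - 1)) • X z + S) =
        D (v - ∑ m ∈ range N, t ^ m • P m y) + (∑ m ∈ range N, t ^ m • (D (P m y) -
          ∑ l ∈ range (N + 1), ((-t ^ n) ^ l / (l.factorial : ℝ)) • adIter X l (P m) z))
        + (R - S) := by
      simp only [smul_sub, sum_sub_distrib, map_sub, map_sum, map_smul, hR]
      abel
    rw [e, add_mul, add_mul]
    refine (norm_add₃_le).trans (add_le_add (add_le_add ?_ ?_) (h₃ t z ht))
    · refine (D.le_opNorm _).trans ?_
      rw [mul_assoc]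
      exact mul_le_mul (hG.norm_fderiv_le hK htn y) hvb (norm_nonneg _) (by positivity)
    · rw [sum_mul]
      refine norm_sum_le_of_le _ fun m _ => ?_
      rw [norm_smul, norm_pow, Real.norm_eq_abs]
      refine (mul_le_of_le_one_left (norm_nonneg _) (pow_le_one₀ (abs_nonneg _) ht)).trans
        ((h₂ m _ y htn).trans (mul_le_mul_of_nonneg_left ?_ (hC₂ m)))
      exact (pow_le_pow_left₀ (abs_nonneg _) htn' _).trans
        (pow_le_pow_of_le_one (abs_nonneg _) ht (by omega))

/-- If the velocity coefficients of `Ψ` are those of `X` up to order `N`, then `Ψ` is close to the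
flow of `X`. -/
lemma IsApproxFlow.norm_sub_le {Y : Fin 2 → Ec d → Ec d} {N : ℕ} (hN : 1 ≤ N)
    {Ψ : ℝ → Ec d → Ec d} {P : ℕ → Ec d → Ec d} (h : IsApproxFlow Y N Ψ P) {X : Ec d → Ec d}
    (hX : IsCbVF X) {f : ℝ → Ec d → Ec d} (hf : IsFlowOf X f) (h0 : P 0 = X)
    (hP : ∀ m, 1 ≤ m → m < N → P m = 0) :
    ∃ C : ℝ, 0 ≤ C ∧ ∀ t x, |t| ≤ 1 → ‖f t x - Ψ t x‖ ≤ C * |t| ^ (N + 1) := by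
  obtain ⟨K, hK⟩ := hX.isCb.lipschitz
  obtain ⟨C, hC, h₁⟩ := h.hasDerivAt
  refine ⟨C * Real.exp K, by positivity, fun t x ht => ?_⟩
  choose! v hv hvb using fun s hs => h₁ s x hs
  have hsum : ∀ (s : ℝ) z, ∑ m ∈ range N, s ^ m • P m z = X z := fun s z => by
    rw [sum_eq_single 0]
    · simp [h0]
    · intro m hm hm0
      rw [hP m (by omega) (mem_range.1 hm)]; simp
    · intro h; simp at h; omega
  have := norm_le_of_norm_deriv_le (u := fun s => f s x - Ψ s x)
    (u' := fun s => X (f s x) - v s) (K := K) (ε := C * |t| ^ N) K.2 (by positivity) ht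
    (fun r hr => (hf.2.2 r x).sub (hv r (hr.trans ht)))
    (fun r hr => by
      have h2 := hvb r (hr.trans ht)
      rw [hsum] at h2
      have e : X (f r x) - v r = (X (f r x) - X (Ψ r x)) - (v r - X (Ψ r x)) := by abel
      rw [e]
      refine (_root_.norm_sub_le _ _).trans (add_le_add (hK.norm_sub_le _ _) (h2.trans ?_))
      gcongr)
  rw [hf.2.1, h.map_zero] at this
  simp only [sub_self, norm_zero, zero_add] at this
  refine this.trans (le_of_eq ?_)
  ring

end Expansion

section L2

lemma l2norm_nonneg (f : Ec d → ℂ) : 0 ≤ l2norm f := Real.sqrt_nonneg _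

lemma lintegral_enorm_sq {f : Ec d → ℂ} (hf : MemLp f 2 volume) :
    ∫⁻ x, ‖f x‖ₑ ^ 2 = ENNReal.ofReal (l2norm f ^ 2) := by
  rw [l2norm, Real.sq_sqrt (integral_nonneg fun x => by positivity),
    ofReal_integral_eq_lintegral_ofReal ((memLp_two_iff_integrable_sq_norm hf.1).1 hf)
      (Filter.Eventually.of_forall fun x => by positivity)]
  refine lintegral_congr fun x => ?_
  rw [ENNReal.ofReal_pow (norm_nonneg _), ofReal_norm]

lemma l2norm_le_of_lintegral {f : Ec d → ℂ} (hf : MemLp f 2 volume) {A : ℝ} (hA : 0 ≤ A)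
    (h : ∫⁻ x, ‖f x‖ₑ ^ 2 ≤ ENNReal.ofReal (A ^ 2)) : l2norm f ≤ A := by
  rw [lintegral_enorm_sq hf, ENNReal.ofReal_le_ofReal_iff (by positivity)] at h
  exact (pow_le_pow_iff_left₀ (l2norm_nonneg f) hA two_ne_zero).1 h

lemma l2norm_eq_toReal {f : Ec d → ℂ} (hf : MemLp f 2 volume) :
    l2norm f = (eLpNorm f 2 volume).toReal := by
  have h : eLpNorm f 2 volume ^ 2 = ENNReal.ofReal (l2norm f ^ 2) := by
    rw [← lintegral_enorm_sq hf]
    simpa using eLpNorm_nnreal_pow_eq_lintegral (f := f) (μ := volume) (p := 2) two_ne_zero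
  have h2 := congrArg ENNReal.toReal h
  rw [ENNReal.toReal_pow, ENNReal.toReal_ofReal (by positivity)] at h2
  exact ((pow_left_inj₀ ENNReal.toReal_nonneg (l2norm_nonneg f) two_ne_zero).1 h2).symm

lemma l2norm_add_le {f g : Ec d → ℂ} (hf : MemLp f 2 volume) (hg : MemLp g 2 volume) :
    l2norm (fun x => f x + g x) ≤ l2norm f + l2norm g := by
  rw [l2norm_eq_toReal hf, l2norm_eq_toReal hg, show (fun x => f x + g x) = f + g from rfl,
    l2norm_eq_toReal (hf.add hg), ← ENNReal.toReal_add hf.2.ne hg.2.ne]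
  exact ENNReal.toReal_mono (ENNReal.add_ne_top.2 ⟨hf.2.ne, hg.2.ne⟩)
    (eLpNorm_add_le hf.1 hg.1 one_le_two)

lemma l2norm_sub_le {f g : Ec d → ℂ} (hf : MemLp f 2 volume) (hg : MemLp g 2 volume) :
    l2norm (fun x => f x - g x) ≤ l2norm f + l2norm g := by
  have h : l2norm (fun x => -g x) = l2norm g := by simp [l2norm]
  rw [← h]
  simpa [sub_eq_add_neg] using l2norm_add_le (g := fun x => -g x) hf hg.neg

lemma IsCc.memLp {φ : Ec d → ℂ} (hφ : IsCc φ) : MemLp φ 2 volume :=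
  hφ.1.continuous.memLp_of_hasCompactSupport hφ.2

/-- `T` is continuous and pulls back Lebesgue measure with density at most `C`. -/
def IsVolBounded (C : NNReal) (T : Ec d → Ec d) : Prop :=
  Continuous T ∧ Measure.map T volume ≤ (C : ENNReal) • volume

variable {C : NNReal} {T : Ec d → Ec d}

lemma isVolBounded_id : IsVolBounded 1 (fun x : Ec d => x) :=
  ⟨continuous_id, by simp [Measure.map_id']⟩

lemma IsVolBounded.mono {C' : NNReal} (h : IsVolBounded C T) (hC : C ≤ C') : IsVolBounded C' T :=
  ⟨h.1, h.2.trans (by gcongr)⟩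

lemma IsVolBounded.comp {C' : NNReal} {S : Ec d → Ec d} (hS : IsVolBounded C' S)
    (hT : IsVolBounded C T) : IsVolBounded (C' * C) (fun x => S (T x)) := by
  refine ⟨hS.1.comp hT.1, ?_⟩
  rw [show (fun x => S (T x)) = S ∘ T from rfl,
    ← Measure.map_map hS.1.measurable hT.1.measurable]
  refine (Measure.map_mono hT.2 hS.1.measurable).trans ?_
  rw [Measure.map_smul, ENNReal.coe_mul, mul_comm, mul_smul]
  gcongr
  exact hS.2

lemma IsVolBounded.lintegral_comp_le (hT : IsVolBounded C T) {f : Ec d → ENNReal}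
    (hf : Measurable f) : ∫⁻ x, f (T x) ≤ C * ∫⁻ x, f x := by
  rw [← lintegral_map hf hT.1.measurable, ← smul_eq_mul, ← lintegral_smul_measure]
  exact lintegral_mono' hT.2 le_rfl

lemma IsVolBounded.memLp_comp (hT : IsVolBounded C T) {f : Ec d → ℂ} (hf : MemLp f 2 volume) :
    MemLp (fun x => f (T x)) 2 volume :=
  (hf.of_measure_le_smul ENNReal.coe_ne_top hT.2).comp_of_map hT.1.aemeasurable

lemma IsVolBounded.l2norm_comp_le (hT : IsVolBounded C T) {f : Ec d → ℂ} (hc : Continuous f)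
    (hf : MemLp f 2 volume) : l2norm (fun x => f (T x)) ≤ √C * l2norm f := by
  refine l2norm_le_of_lintegral (hT.memLp_comp hf)
    (mul_nonneg (Real.sqrt_nonneg _) (l2norm_nonneg f)) ?_
  refine (hT.lintegral_comp_le (f := fun x => ‖f x‖ₑ ^ 2)
    (hc.measurable.enorm.pow_const 2)).trans ?_
  rw [lintegral_enorm_sq hf, mul_pow, Real.sq_sqrt C.coe_nonneg, ENNReal.ofReal_mul C.coe_nonneg,
    ENNReal.ofReal_coe_nnreal]

lemma l2norm_comp_comp_sub_le {S : Ec d → Ec d} {C' : NNReal} (hS : IsVolBounded C' S)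
    (hT : IsVolBounded C T) {φ : Ec d → ℂ} (hφ : IsCc φ) :
    l2norm (fun x => φ (S (T x)) - φ x) ≤
      √C * l2norm (fun x => φ (S x) - φ x) + l2norm (fun x => φ (T x) - φ x) := by
  have hs := (hS.memLp_comp hφ.memLp).sub hφ.memLp
  have hcont : Continuous fun x => φ (S x) - φ x :=
    (hφ.1.continuous.comp hS.1).sub hφ.1.continuous
  refine le_trans ?_ (add_le_add_left (hT.l2norm_comp_le hcont hs) _)
  have := l2norm_add_le (hT.memLp_comp hs) ((hT.memLp_comp hφ.memLp).sub hφ.memLp)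
  simp only [Pi.sub_apply, sub_add_sub_cancel] at this
  exact this

/-- A homeomorphism with Lipschitz inverse distorts volume by a bounded factor. -/
lemma isVolBounded_of_lipschitz_inverse {S : Ec d → Ec d} {L : NNReal} (hT : Continuous T)
    (hS : LipschitzWith L S) (hST : ∀ x, S (T x) = x) : IsVolBounded (L ^ d) T := by
  refine ⟨hT, Measure.le_iff.2 fun s hs => ?_⟩
  rw [Measure.map_apply hT.measurable hs]
  have hsub : T ⁻¹' s ⊆ S '' s := fun x hx => ⟨T x, hx, hST x⟩
  refine (measure_mono hsub).trans ?_
  have hμ := Measure.isAddLeftInvariant_eq_smul (volume : Measure (Ec d))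
    (Measure.hausdorffMeasure (d : ℝ))
  rw [hμ]
  simp only [Measure.smul_apply, ENNReal.smul_def, smul_eq_mul]
  rw [mul_left_comm]
  gcongr
  have := hS.hausdorffMeasure_image_le (d := d) (Nat.cast_nonneg d) s
  rwa [ENNReal.rpow_natCast, ← ENNReal.coe_pow] at this

lemma IsFlowOf.exists_isVolBounded {X : Ec d → Ec d} {G : ℝ → Ec d → Ec d} (hX : IsCbVF X)
    (hG : IsFlowOf X G) : ∃ C : NNReal, ∀ s, |s| ≤ 1 → IsVolBounded C (G s) := by
  obtain ⟨K, hK⟩ := hX.isCb.lipschitz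
  refine ⟨_, fun s hs => isVolBounded_of_lipschitz_inverse (S := G (-s)) (hG.contDiff s).continuous
    (hG.lipschitzWith hK (by rwa [abs_neg])) fun x => ?_⟩
  rw [← flow_add hK hG.2.1 hG.2.2, neg_add_cancel, hG.2.1]

end L2

section Holder

variable {φ : Ec d → ℂ} {γ : ℝ}

lemma IsCc.memLp_translate_sub (hφ : IsCc φ) (z : Ec d) :
    MemLp (fun x => φ (x - z) - φ x) 2 volume :=
  (hφ.memLp.comp_measurePreserving (measurePreserving_sub_right volume z)).sub hφ.memLp

lemma IsCc.exists_l2norm_translate_sub_le (hφ : IsCc φ) :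
    ∃ A : ℝ, 0 ≤ A ∧ ∀ z : Ec d, ‖z‖ ≤ 1 → l2norm (fun x => φ (x - z) - φ x) ≤ A * ‖z‖ := by
  obtain ⟨L, hL⟩ := hφ.1.lipschitzWith_of_hasCompactSupport (𝕂 := ℝ) hφ.2 (by simp)
  set K := Metric.cthickening 1 (tsupport φ) with hK
  have hKc : IsCompact K := hφ.2.isCompact.cthickening
  refine ⟨L * √(volume.real K), by positivity, fun z hz => ?_⟩
  refine l2norm_le_of_lintegral (hφ.memLp_translate_sub z) (by positivity) ?_
  have h1 : ∀ x, ‖φ (x - z) - φ x‖ₑ ^ 2 ≤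
      K.indicator (fun _ => ENNReal.ofReal ((L * ‖z‖) ^ 2)) x := by
    intro x
    by_cases hx : x ∈ K
    · rw [Set.indicator_of_mem hx, ENNReal.ofReal_pow (by positivity), ← ofReal_norm]
      gcongr
      have := hL.norm_sub_le (x - z) x
      rwa [sub_sub_cancel_left, norm_neg] at this
    · have hx1 : x ∉ tsupport φ := fun h => hx (Metric.self_subset_cthickening _ h)
      have hx2 : x - z ∉ tsupport φ := fun h =>
        hx (Metric.mem_cthickening_of_dist_le x (x - z) 1 _ h (by simpa [dist_eq_norm] using hz))
      rw [image_eq_zero_of_notMem_tsupport hx1, image_eq_zero_of_notMem_tsupport hx2]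
      simp
  refine (lintegral_mono h1).trans ?_
  rw [lintegral_indicator_const hKc.isClosed.measurableSet,
    ← ENNReal.ofReal_toReal hKc.measure_lt_top.ne, ← ENNReal.ofReal_mul (by positivity)]
  refine ENNReal.ofReal_le_ofReal (le_of_eq ?_)
  have : √(volume.real K) ^ 2 = volume.real K := Real.sq_sqrt measureReal_nonneg
  rw [mul_pow, mul_pow, mul_pow, this, Measure.real]
  ring

lemma IsCc.bddAbove_holder (hφ : IsCc φ) (hγ1 : γ ≤ 1) :
    BddAbove ((fun z : Ec d => ‖z‖ ^ (-γ) * l2norm fun x => φ (x - z) - φ x) ''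
      {z : Ec d | 0 < ‖z‖ ∧ ‖z‖ ≤ 1}) := by
  obtain ⟨A, hA, h⟩ := hφ.exists_l2norm_translate_sub_le
  refine ⟨A, ?_⟩
  rintro _ ⟨z, ⟨hz0, hz1⟩, rfl⟩
  calc ‖z‖ ^ (-γ) * l2norm (fun x => φ (x - z) - φ x) ≤ ‖z‖ ^ (-γ) * (A * ‖z‖) := by
        gcongr; exact h z hz1
    _ = A * ‖z‖ ^ (1 - γ) := by
        rw [show 1 - γ = -γ + 1 by ring, Real.rpow_add hz0, Real.rpow_one]; ring
    _ ≤ A * 1 := by gcongr; exact Real.rpow_le_one hz0.le hz1 (by linarith)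
    _ = A := mul_one A

lemma l2norm_le_uHolder (γ : ℝ) (φ : Ec d → ℂ) : l2norm φ ≤ uHolder γ φ := by
  refine le_add_of_nonneg_right (Real.sSup_nonneg ?_)
  rintro _ ⟨z, -, rfl⟩
  exact mul_nonneg (by positivity) (l2norm_nonneg _)

lemma uHolder_nonneg (γ : ℝ) (φ : Ec d → ℂ) : 0 ≤ uHolder γ φ :=
  (l2norm_nonneg φ).trans (l2norm_le_uHolder γ φ)

lemma IsCc.l2norm_translate_sub_le (hφ : IsCc φ) (hγ1 : γ ≤ 1) {z : Ec d} (hz : ‖z‖ ≤ 1) :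
    l2norm (fun x => φ (x - z) - φ x) ≤ ‖z‖ ^ γ * uHolder γ φ := by
  rcases (norm_nonneg z).eq_or_lt with h | h
  · have : z = 0 := norm_eq_zero.1 h.symm
    subst this
    have h0 : l2norm (fun x => φ (x - 0) - φ x) = 0 := by simp [l2norm]
    rw [h0]
    exact mul_nonneg (by positivity) (uHolder_nonneg γ φ)
  · have h1 : ‖z‖ ^ (-γ) * l2norm (fun x => φ (x - z) - φ x) ≤ uHolder γ φ :=
      (le_csSup (hφ.bddAbove_holder hγ1) ⟨z, ⟨h, hz⟩, rfl⟩).trans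
        (le_add_of_nonneg_left (l2norm_nonneg φ))
    rw [Real.rpow_neg h.le, inv_mul_le_iff₀ (by positivity)] at h1
    exact h1

variable {C : NNReal} {S T : Ec d → Ec d} {ε : ℝ}

/-- Averaging over a ball: a pointwise bound of the difference of `φ ∘ S` and `φ ∘ T` by
translates. -/
lemma IsCc.volume_ball_mul_enorm_sq_le (hφ : IsCc φ) {p q : Ec d} (hpq : ‖p - q‖ ≤ ε) :
    volume (Metric.closedBall (0 : Ec d) ε) * ‖φ p - φ q‖ₑ ^ 2 ≤
      2 * ∫⁻ w in Metric.closedBall (0 : Ec d) (2 * ε),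
        (‖φ (p - w) - φ p‖ₑ ^ 2 + ‖φ (q - w) - φ q‖ₑ ^ 2) := by
  have hm : ∀ p, Measurable fun w => ‖φ (p - w) - φ p‖ₑ ^ 2 := fun p =>
    (((hφ.1.continuous.comp (continuous_const.sub continuous_id)).sub
      continuous_const).measurable.enorm).pow_const 2
  have hpt : ∀ w, ‖φ p - φ q‖ₑ ^ 2 ≤
      2 * (‖φ (p - w) - φ p‖ₑ ^ 2 + ‖φ (q - (w - (p - q))) - φ q‖ₑ ^ 2) := by
    intro w
    have e : φ p - φ q = (φ (q - (w - (p - q))) - φ q) - (φ (p - w) - φ p) := by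
      rw [show q - (w - (p - q)) = p - w by abel]; ring
    have h1 : ‖φ p - φ q‖ ≤ ‖φ (q - (w - (p - q))) - φ q‖ + ‖φ (p - w) - φ p‖ := by
      rw [e]; exact norm_sub_le _ _
    have h2 : ‖φ p - φ q‖ ^ 2 ≤
        2 * (‖φ (p - w) - φ p‖ ^ 2 + ‖φ (q - (w - (p - q))) - φ q‖ ^ 2) := by
      refine (pow_le_pow_left₀ (norm_nonneg _) h1 2).trans ?_
      nlinarith [sq_nonneg (‖φ (q - (w - (p - q))) - φ q‖ - ‖φ (p - w) - φ p‖)]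
    have h3 := ENNReal.ofReal_le_ofReal h2
    rwa [ENNReal.ofReal_mul (by norm_num), ENNReal.ofReal_add (by positivity) (by positivity),
      ENNReal.ofReal_pow (norm_nonneg _), ENNReal.ofReal_pow (norm_nonneg _),
      ENNReal.ofReal_pow (norm_nonneg _), ofReal_norm, ofReal_norm, ofReal_norm,
      ENNReal.ofReal_ofNat] at h3
  set B := Metric.closedBall (0 : Ec d) ε
  set B' := Metric.closedBall (0 : Ec d) (2 * ε)
  have hε : 0 ≤ ε := (norm_nonneg _).trans hpq
  have hBB' : B ⊆ B' := Metric.closedBall_subset_closedBall (by linarith)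
  have hshift : ∫⁻ w in B, ‖φ (q - (w - (p - q))) - φ q‖ₑ ^ 2 ≤
      ∫⁻ w in B', ‖φ (q - w) - φ q‖ₑ ^ 2 := by
    have h1 := (measurePreserving_sub_right (volume : Measure (Ec d)) (p - q)).setLIntegral_comp_preimage
      (Metric.isClosed_closedBall (x := (0 : Ec d)) (ε := 2 * ε)).measurableSet (hm q)
    rw [← h1]
    refine lintegral_mono_set fun w hw => ?_
    rw [Set.mem_preimage, mem_closedBall_zero_iff]
    rw [mem_closedBall_zero_iff] at hw
    linarith [norm_sub_le w (p - q)]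
  calc volume B * ‖φ p - φ q‖ₑ ^ 2 = ∫⁻ _ in B, ‖φ p - φ q‖ₑ ^ 2 := by
        rw [setLIntegral_const, mul_comm]
    _ ≤ ∫⁻ w in B, 2 * (‖φ (p - w) - φ p‖ₑ ^ 2 + ‖φ (q - (w - (p - q))) - φ q‖ₑ ^ 2) :=
        lintegral_mono fun w => hpt w
    _ = 2 * ((∫⁻ w in B, ‖φ (p - w) - φ p‖ₑ ^ 2) +
          ∫⁻ w in B, ‖φ (q - (w - (p - q))) - φ q‖ₑ ^ 2) := by
        rw [lintegral_const_mul' _ _ (by norm_num), lintegral_add_left (hm p)]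
    _ ≤ 2 * ((∫⁻ w in B', ‖φ (p - w) - φ p‖ₑ ^ 2) + ∫⁻ w in B', ‖φ (q - w) - φ q‖ₑ ^ 2) := by
        gcongr
    _ = _ := by rw [lintegral_add_left (hm p)]

lemma IsCc.lintegral_setLIntegral_translate_le (hφ : IsCc φ) (hγ0 : 0 < γ) (hγ1 : γ ≤ 1)
    {r : ℝ} (hr : r ≤ 1) (hT : IsVolBounded C T) :
    ∫⁻ x, ∫⁻ w in Metric.closedBall (0 : Ec d) r, ‖φ (T x - w) - φ (T x)‖ₑ ^ 2 ≤
      C * ENNReal.ofReal ((r ^ γ * uHolder γ φ) ^ 2) *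
        volume (Metric.closedBall (0 : Ec d) r) := by
  have hc : Continuous fun p : Ec d × Ec d => ‖φ (T p.1 - p.2) - φ (T p.1)‖ₑ ^ 2 := by
    have h1 := hφ.1.continuous
    have h2 := hT.1
    fun_prop
  rw [lintegral_lintegral_swap hc.measurable.aemeasurable]
  refine (setLIntegral_mono' Metric.isClosed_closedBall.measurableSet (fun w hw => ?_)).trans
    (setLIntegral_const _ _).le
  have hc' : Continuous fun y : Ec d => ‖φ (y - w) - φ y‖ₑ ^ 2 := by
    have h1 := hφ.1.continuous
    fun_prop
  refine (hT.lintegral_comp_le hc'.measurable).trans ?_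
  rw [lintegral_enorm_sq (hφ.memLp_translate_sub w)]
  rw [mem_closedBall_zero_iff] at hw
  gcongr
  · exact l2norm_nonneg _
  · refine (hφ.l2norm_translate_sub_le hγ1 (hw.trans hr)).trans ?_
    have := uHolder_nonneg γ φ
    gcongr

/-- Nearby maps of bounded distortion act on `L²` with a Hölder-controlled difference. -/
lemma IsCc.l2norm_comp_sub_comp_le (hφ : IsCc φ) (hγ0 : 0 < γ) (hγ1 : γ ≤ 1) (hε : 0 ≤ ε)
    (hS : IsVolBounded C S) (hT : IsVolBounded C T) (h : ∀ x, ‖S x - T x‖ ≤ ε) :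
    l2norm (fun x => φ (S x) - φ (T x)) ≤
      2 * √(C * 2 ^ d) * (2 * ε) ^ γ * uHolder γ φ := by
  have hU := uHolder_nonneg γ φ
  have hmem := (hS.memLp_comp hφ.memLp).sub (hT.memLp_comp hφ.memLp)
  rcases hε.eq_or_lt with rfl | hε
  · have e : S = T := funext fun x => sub_eq_zero.1 (norm_le_zero_iff.1 (h x))
    have h0 : l2norm (fun x => φ (S x) - φ (T x)) = 0 := by simp [e, l2norm]
    rw [h0]
    positivity
  rcases le_or_gt (2 * ε) 1 with hε1 | hε1
  · refine l2norm_le_of_lintegral hmem (by positivity) ?_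
    set B := Metric.closedBall (0 : Ec d) ε with hB
    have hB0 : volume B ≠ 0 := (Metric.measure_closedBall_pos volume _ hε).ne'
    have hBt : volume B ≠ ⊤ := measure_closedBall_lt_top.ne
    have hB2 : volume (Metric.closedBall (0 : Ec d) (2 * ε)) = ENNReal.ofReal (2 ^ d) * volume B := by
      have := Measure.addHaar_closedBall_mul (volume : Measure (Ec d)) 0 zero_le_two hε.le
      rwa [finrank_euclideanSpace_fin, Measure.addHaar_closedBall_center] at this
    have hc : ∀ {T : Ec d → Ec d}, Continuous T →
        Measurable fun p : Ec d × Ec d => ‖φ (T p.1 - p.2) - φ (T p.1)‖ₑ ^ 2 := fun {T} h2 => by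
      have h1 := hφ.1.continuous
      have : Continuous fun p : Ec d × Ec d => ‖φ (T p.1 - p.2) - φ (T p.1)‖ₑ ^ 2 := by fun_prop
      exact this.measurable
    have hS1 := (hc hS.1).lintegral_prod_right' (ν := volume.restrict
      (Metric.closedBall (0 : Ec d) (2 * ε)))
    have key : volume B * ∫⁻ x, ‖φ (S x) - φ (T x)‖ₑ ^ 2 ≤
        volume B * ENNReal.ofReal ((2 * √(C * 2 ^ d) * (2 * ε) ^ γ * uHolder γ φ) ^ 2) := by
      calc volume B * ∫⁻ x, ‖φ (S x) - φ (T x)‖ₑ ^ 2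
          = ∫⁻ x, volume B * ‖φ (S x) - φ (T x)‖ₑ ^ 2 := (lintegral_const_mul' _ _ hBt).symm
        _ ≤ ∫⁻ x, 2 * ∫⁻ w in Metric.closedBall (0 : Ec d) (2 * ε),
              (‖φ (S x - w) - φ (S x)‖ₑ ^ 2 + ‖φ (T x - w) - φ (T x)‖ₑ ^ 2) :=
            lintegral_mono fun x => hφ.volume_ball_mul_enorm_sq_le (h x)
        _ = 2 * ((∫⁻ x, ∫⁻ w in Metric.closedBall (0 : Ec d) (2 * ε),
                ‖φ (S x - w) - φ (S x)‖ₑ ^ 2) +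
              ∫⁻ x, ∫⁻ w in Metric.closedBall (0 : Ec d) (2 * ε),
                ‖φ (T x - w) - φ (T x)‖ₑ ^ 2) := by
            rw [lintegral_const_mul' _ _ (by norm_num), ← lintegral_add_left hS1]
            congr 1
            refine lintegral_congr fun x => ?_
            exact lintegral_add_left ((hc hS.1).comp measurable_prodMk_left) _
        _ ≤ 2 * (C * ENNReal.ofReal (((2 * ε) ^ γ * uHolder γ φ) ^ 2) *
                volume (Metric.closedBall (0 : Ec d) (2 * ε)) +
              C * ENNReal.ofReal (((2 * ε) ^ γ * uHolder γ φ) ^ 2) *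
                volume (Metric.closedBall (0 : Ec d) (2 * ε))) := by
            gcongr
            · exact hφ.lintegral_setLIntegral_translate_le hγ0 hγ1 hε1 hS
            · exact hφ.lintegral_setLIntegral_translate_le hγ0 hγ1 hε1 hT
        _ = volume B * ENNReal.ofReal (4 * (C * 2 ^ d) * ((2 * ε) ^ γ * uHolder γ φ) ^ 2) := by
            rw [hB2, ENNReal.ofReal_mul (by positivity), ENNReal.ofReal_mul (by positivity),
              ENNReal.ofReal_mul C.coe_nonneg, ENNReal.ofReal_coe_nnreal, ENNReal.ofReal_ofNat]
            ring
        _ = _ := by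
            congr 2
            rw [mul_assoc (2 * √(C * 2 ^ d)), mul_pow (2 * √(C * 2 ^ d)), mul_pow 2,
              Real.sq_sqrt (by positivity)]
            ring
    exact (ENNReal.mul_le_mul_iff_right hB0 hBt).1 key
  · have h1 : √C ≤ √(C * 2 ^ d) :=
      Real.sqrt_le_sqrt (le_mul_of_one_le_right C.coe_nonneg (one_le_pow₀ one_le_two))
    have h2 : 1 ≤ (2 * ε) ^ γ := Real.one_le_rpow hε1.le hγ0.le
    have h3 := l2norm_nonneg φ
    calc l2norm (fun x => φ (S x) - φ (T x)) ≤ √C * l2norm φ + √C * l2norm φ :=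
          (l2norm_sub_le (hS.memLp_comp hφ.memLp) (hT.memLp_comp hφ.memLp)).trans (add_le_add
            (hS.l2norm_comp_le hφ.1.continuous hφ.memLp)
            (hT.l2norm_comp_le hφ.1.continuous hφ.memLp))
      _ = 2 * √C * 1 * l2norm φ := by ring
      _ ≤ _ := by
          gcongr
          exact l2norm_le_uHolder γ φ

end Holder

section Product

variable {Y : Fin 2 → Ec d → Ec d} {f1 f2 : ℝ → Ec d → Ec d}

/-- A product of the flows of `Y 0`, `Y 1` and of combinations `Z j` of commutators of length
`j ≤ k`, run for time `t ^ j`, which matches the flow of `Y 0 + Y 1` to order `k`. -/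
lemma exists_approxFlow (hY : ∀ i, IsCbVF (Y i)) (hf1 : IsFlowOf (Y 0) f1)
    (hf2 : IsFlowOf (Y 1) f2) {N k : ℕ} (hk : 1 ≤ k) (hkN : k ≤ N) :
    ∃ (Z : ℕ → Ec d → Ec d) (g : ℕ → ℝ → Ec d → Ec d) (Ψ : ℝ → Ec d → Ec d)
      (P : ℕ → Ec d → Ec d) (C : NNReal) (A : ℝ),
      (∀ j, 2 ≤ j → j ≤ k → Z j ∈ lieSpan Y j ∧ IsFlowOf (Z j) (g j)) ∧
      IsApproxFlow Y N Ψ P ∧ P 0 = Y 0 + Y 1 ∧ (∀ m, 1 ≤ m → m < k → P m = 0) ∧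
      (∀ t, |t| ≤ 1 → IsVolBounded C (Ψ t)) ∧ 0 ≤ A ∧
      ∀ φ, IsCc φ → ∀ t, |t| ≤ 1 → l2norm (fun x => φ (Ψ t x) - φ x) ≤
        A * (l2norm (fun x => φ (f1 t x) - φ x) + l2norm (fun x => φ (f2 t x) - φ x) +
          ∑ j ∈ Finset.Icc 2 k, l2norm (fun x => φ (g j (t ^ j) x) - φ x)) := by
  induction k, hk using Nat.le_induction with
  | base =>
    have hmem : ∀ i, Y i ∈ lieSpan Y 1 := fun i => multiComm_mem_lieSpan Y [i] rfl
    obtain ⟨C₁, h₁⟩ := hf1.exists_isVolBounded (hY 0)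
    obtain ⟨C₂, h₂⟩ := hf2.exists_isVolBounded (hY 1)
    refine ⟨0, 0, fun t x => f1 (t ^ 1) (f2 (t ^ 1) x), _, C₁ * C₂, √C₂ + 1,
      fun j h1 h2 => absurd h2 (by omega),
      ((isApproxFlow_id Y N).comp hY le_rfl hkN (hmem 1) hf2).comp hY le_rfl hkN (hmem 0) hf1,
      ?_, fun m h1 h2 => absurd h2 (by omega), fun t ht => ?_, by positivity, fun φ hφ t ht => ?_⟩
    · rw [nextCoef_of_lt _ _ hkN one_pos, nextCoef_of_lt _ _ hkN one_pos]
      simp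
    · simp only [pow_one]; exact (h₁ t ht).comp (h₂ t ht)
    · simp only [pow_one]
      have h := l2norm_comp_comp_sub_le (h₁ t ht) (h₂ t ht) hφ
      have e : Finset.Icc 2 1 = ∅ := rfl
      rw [e, sum_empty, add_zero]
      have p1 := l2norm_nonneg fun x => φ (f1 t x) - φ x
      have p2 := mul_nonneg (Real.sqrt_nonneg C₂) (l2norm_nonneg fun x => φ (f2 t x) - φ x)
      linarith
  | succ k hk ih =>
    obtain ⟨Z, g, Ψ, P, C, A, hZ, hΨ, hP0, hP, hvol, hA, hest⟩ := ih (by omega)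
    set X : Ec d → Ec d := (-((k + 1 : ℕ) : ℝ)⁻¹) • P k with hXdef
    have hX : X ∈ lieSpan Y (k + 1) := Submodule.smul_mem _ _ (hΨ.mem_lieSpan k)
    have hXb := isCbVF_of_mem_lieSpan hY hX
    obtain ⟨G, hG⟩ := hXb.exists_isFlowOf
    obtain ⟨C', hC'⟩ := hG.exists_isVolBounded hXb
    have hpow : ∀ t : ℝ, |t| ≤ 1 → |t ^ (k + 1)| ≤ 1 := fun t ht => by
      rw [abs_pow]; exact pow_le_one₀ (abs_nonneg _) ht
    refine ⟨Function.update Z (k + 1) X, Function.update g (k + 1) G,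
      fun t x => G (t ^ (k + 1)) (Ψ t x), _, C' * C, √C + A, fun j h1 h2 => ?_,
      hΨ.comp hY (by omega) hkN hX hG, ?_, fun m h1 h2 => ?_,
      fun t ht => (hC' _ (hpow t ht)).comp (hvol t ht), by positivity, fun φ hφ t ht => ?_⟩
    · rcases eq_or_ne j (k + 1) with rfl | hj
      · simpa using ⟨hX, hG⟩
      · simpa [hj] using hZ j h1 (by omega)
    · rw [nextCoef_of_lt _ _ (by omega) (by omega), if_neg (by omega), zero_add, hP0]
    · rw [nextCoef_of_lt _ _ (by omega) (by omega)]
      rcases eq_or_ne m k with rfl | hm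
      · have : ((m + 1 : ℕ) : ℝ) ≠ 0 := by positivity
        rw [if_pos rfl, hXdef, smul_smul, mul_neg, mul_inv_cancel₀ this, neg_one_smul,
          neg_add_cancel]
      · rw [if_neg (by omega), hP m h1 (by omega), zero_add]
    · have h := l2norm_comp_comp_sub_le (hC' _ (hpow t ht)) (hvol t ht) hφ
      have h2 := hest φ hφ t ht
      rw [sum_Icc_succ_top (by omega), Function.update_self,
        sum_congr rfl fun j hj => by
          rw [Function.update_of_ne (by have := (Finset.mem_Icc.1 hj).2; omega)]]
      have p1 := l2norm_nonneg fun x => φ (f1 t x) - φ x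
      have p2 := l2norm_nonneg fun x => φ (f2 t x) - φ x
      have p3 := l2norm_nonneg fun x => φ (G (t ^ (k + 1)) x) - φ x
      have p4 : 0 ≤ ∑ j ∈ Finset.Icc 2 k, l2norm (fun x => φ (g j (t ^ j) x) - φ x) :=
        sum_nonneg fun j _ => l2norm_nonneg _
      have p5 := mul_nonneg (Real.sqrt_nonneg C) (add_nonneg (add_nonneg p1 p2) p4)
      have p6 := mul_nonneg hA p3
      linarith

end Product

/-- **Lemma 4.4 of ter Elst–Robinson, "Uniform subellipticity".**
Let `Y₁, Y₂` be `C_b^∞`-vector fields on `ℝ^d`, `γ ∈ (0,1]` and `N ≥ 2`.  Then there are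
`c > 0` and `C_b^∞`-vector fields `Z₂, …, Z_N`, each `Z_j` a real linear combination of
iterated commutators of `Y₁, Y₂` of length `j`, such that
`‖e^{t(Y₁+Y₂)}φ − φ‖₂ ≤ c (‖e^{tY₁}φ − φ‖₂ + ‖e^{tY₂}φ − φ‖₂ + ∑_{j=2}^N ‖e^{t^j Z_j}φ − φ‖₂
  + |t|^{γ(N+1)} ‖φ‖_{2;γ})` for all `φ ∈ C_c^∞(ℝ^d)` and `t ∈ [−1,1]`. -/
theorem holder_sum_flow_estimate (d N : ℕ) (hN : 2 ≤ N)
    (Y : Fin 2 → Ec d → Ec d) (hY : ∀ i, IsCbVF (Y i))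
    (γ : ℝ) (hγ0 : 0 < γ) (hγ1 : γ ≤ 1)
    (f12 f1 f2 : ℝ → Ec d → Ec d)
    (hf12 : IsFlowOf (fun x => Y 0 x + Y 1 x) f12)
    (hf1 : IsFlowOf (Y 0) f1) (hf2 : IsFlowOf (Y 1) f2) :
    ∃ c : ℝ, 0 < c ∧
    ∃ Z : ℕ → Ec d → Ec d, ∃ g : ℕ → ℝ → Ec d → Ec d,
      (∀ j, 2 ≤ j → j ≤ N →
        IsCbVF (Z j) ∧ IsFlowOf (Z j) (g j) ∧
        ∃ coef : (Fin j → Fin 2) → ℝ,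
          Z j = fun x => ∑ v : Fin j → Fin 2, coef v • multiComm Y (List.ofFn v) x) ∧
      ∀ (φ : Ec d → ℂ), IsCc φ → ∀ t : ℝ, |t| ≤ 1 →
        l2norm (fun x => φ (f12 t x) - φ x) ≤
          c * (l2norm (fun x => φ (f1 t x) - φ x) +
               l2norm (fun x => φ (f2 t x) - φ x) +
               (∑ j ∈ Finset.Icc 2 N, l2norm (fun x => φ (g j (t ^ j) x) - φ x)) +
               |t| ^ (γ * (N + 1)) * uHolder γ φ) := by
  obtain ⟨Z, g, Ψ, P, C, A, hZ, hΨ, hP0, hP, hvol, hA, hest⟩ :=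
    exists_approxFlow hY hf1 hf2 (by omega : 1 ≤ N) le_rfl
  have hX : IsCbVF (fun x => Y 0 x + Y 1 x) := IsCb.add (hY 0) (hY 1)
  obtain ⟨C', hC'⟩ := hf12.exists_isVolBounded hX
  obtain ⟨C₀, hC₀, hclose⟩ := hΨ.norm_sub_le (by omega) hX hf12 hP0 hP
  set B : ℝ := 2 * √((max C C' : NNReal) * 2 ^ d) * (2 * C₀) ^ γ with hB
  have hB0 : 0 ≤ B := by positivity
  refine ⟨A + B + 1, by positivity, Z, g, fun j h1 h2 => ?_, fun φ hφ t ht => ?_⟩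
  · obtain ⟨hm, hflow⟩ := hZ j h1 h2
    exact ⟨isCbVF_of_mem_lieSpan hY hm, hflow, exists_coef_of_mem_lieSpan hm⟩
  have hU := uHolder_nonneg γ φ
  have v1 := (hC' t ht).mono (le_max_right C C')
  have v2 := (hvol t ht).mono (le_max_left C C')
  have h1 := hφ.l2norm_comp_sub_comp_le hγ0 hγ1 (by positivity) v1 v2 fun x => hclose t x ht
  have e : (2 * (C₀ * |t| ^ (N + 1))) ^ γ = (2 * C₀) ^ γ * |t| ^ (γ * (N + 1)) := by
    rw [← mul_assoc, Real.mul_rpow (by positivity) (by positivity), ← Real.rpow_natCast |t|,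
      ← Real.rpow_mul (abs_nonneg t), mul_comm γ]
    push_cast
    rfl
  rw [e, ← mul_assoc, ← hB, mul_assoc] at h1
  have h2 := hest φ hφ t ht
  have h3 := l2norm_add_le ((v1.memLp_comp hφ.memLp).sub (v2.memLp_comp hφ.memLp))
    ((v2.memLp_comp hφ.memLp).sub hφ.memLp)
  simp only [Pi.sub_apply, sub_add_sub_cancel] at h3
  have h4 : l2norm (fun x => φ (f12 t x) - φ x) ≤ l2norm (fun x => φ (f12 t x) - φ (Ψ t x)) +
      l2norm (fun x => φ (Ψ t x) - φ x) := h3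
  have p1 := l2norm_nonneg fun x => φ (f1 t x) - φ x
  have p2 := l2norm_nonneg fun x => φ (f2 t x) - φ x
  have p3 : 0 ≤ ∑ j ∈ Finset.Icc 2 N, l2norm (fun x => φ (g j (t ^ j) x) - φ x) :=
    sum_nonneg fun j _ => l2norm_nonneg _
  have p4 : 0 ≤ |t| ^ (γ * (N + 1)) * uHolder γ φ := by positivity
  have p5 := mul_nonneg hB0 (add_nonneg (add_nonneg p1 p2) p3)
  have p6 := mul_nonneg hA p4
  linarith

end
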